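/- Fix β ∈ (−1,1). As Δ = 2−α → 0⁺, the Fisher information of the characteristic exponent satisfies 4·Δ·log(1/Δ)·I_{αα}(α) → 1, i.e. I_{αα}(α) = (1 + o(1)) / (4Δ·log(1/Δ)), where I_{αα}(α) = ∫_ℝ f_α(x;α,β)² / f(x;α,β) dx. -/

import Mathlib

open MeasureTheory Filter Set Topology Real

/-- Shift parameter ζ = −β·tan(πα/2) in Zolotarev's (M) parameterization. -/
noncomputable def zetaPar (α β : ℝ) : ℝ := -β * Real.tan (Real.pi * α / 2)

/-- Standard stable density in Zolotarev's (M) parameterization, via the inversion formula. -/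
noncomputable def stableDensity (α β x : ℝ) : ℝ :=
  (1 / Real.pi) *
    (∫ t in Set.Ioi (0 : ℝ),
      Complex.exp (-(Complex.I * (t : ℂ) * (x : ℂ))) *
        Complex.exp (-(((t ^ α : ℝ) : ℂ)) *
          (1 + Complex.I * (β : ℂ) * ((Real.tan (Real.pi * α / 2) : ℝ) : ℂ) *
            (((t ^ (1 - α) : ℝ) : ℂ) - 1)))).re

/-- The N(0,2) density f(y;2). -/
noncomputable def normalDensity (y : ℝ) : ℝ :=
  (1 / (2 * Real.sqrt Real.pi)) * Real.exp (-(y ^ 2) / 4)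

/-- Partial derivative of the stable density with respect to α. -/
noncomputable def fAlpha (α β x : ℝ) : ℝ := deriv (fun a : ℝ => stableDensity a β x) α

/-- Partial derivative of the stable density with respect to β. -/
noncomputable def fBeta (α β x : ℝ) : ℝ := deriv (fun b : ℝ => stableDensity α b x) β

/-- Derivative of the stable density in x. -/
noncomputable def fX (α β x : ℝ) : ℝ := deriv (stableDensity α β) x

/-- The scale score numerator f_σ = −f − x·f′. -/
noncomputable def fSig (α β x : ℝ) : ℝ := -stableDensity α β x - x * fX α β x


section expansion

/-- `t ^ (-s)` as a complex number. -/
noncomputable def TT (s t : ℝ) : ℂ := ((t ^ (-s) : ℝ) : ℂ)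
/-- `log t` as a complex number. -/
noncomputable def LL (t : ℝ) : ℂ := ((Real.log t : ℝ) : ℂ)
/-- the coefficient `1 + i a`. -/
noncomputable def cA (a : ℝ) : ℂ := 1 + Complex.I * a
/-- the exponent `ψ`. -/
noncomputable def ps0 (s a t : ℝ) : ℂ := -(cA a) * t ^ 2 * TT s t + Complex.I * a * t
noncomputable def ps1 (s a t : ℝ) : ℂ := -(cA a) * (2 - s) * t * TT s t + Complex.I * a
noncomputable def ps2 (s a t : ℝ) : ℂ := -(cA a) * (2 - s) * (1 - s) * TT s t
noncomputable def tps3 (s a t : ℝ) : ℂ := cA a * (2 - s) * (1 - s) * s * TT s t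
noncomputable def ch0 (s a b t : ℝ) : ℂ :=
  cA a * t ^ 2 * TT s t * LL t - Complex.I * b * t ^ 2 * TT s t
noncomputable def ch0t (s a b t : ℝ) : ℂ :=
  cA a * t * TT s t * LL t - Complex.I * b * t * TT s t
noncomputable def ch1 (s a b t : ℝ) : ℂ :=
  cA a * ((2 - s) * t * TT s t * LL t + t * TT s t) - Complex.I * b * (2 - s) * t * TT s t
noncomputable def ch1t (s a b t : ℝ) : ℂ :=
  cA a * ((2 - s) * TT s t * LL t + TT s t) - Complex.I * b * (2 - s) * TT s t
noncomputable def ch2 (s a b t : ℝ) : ℂ :=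
  cA a * ((2 - s) * (1 - s) * TT s t * LL t + (3 - 2 * s) * TT s t)
    - Complex.I * b * (2 - s) * (1 - s) * TT s t
noncomputable def tch3 (s a b t : ℝ) : ℂ :=
  cA a * (-s * (2 - s) * (1 - s) * TT s t * LL t + (2 - 6 * s + 3 * s ^ 2) * TT s t)
    + Complex.I * b * (2 - s) * (1 - s) * s * TT s t
noncomputable def EE (s a t : ℝ) : ℂ := Complex.exp (ps0 s a t)
noncomputable def ee (t : ℝ) : ℂ := Complex.exp (-(t : ℂ))

noncomputable def R0 (s a b t : ℝ) : ℂ :=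
  ch0 s a b t * (EE s a t - ee t) + Complex.I * b * t * EE s a t
noncomputable def R1 (s a b t : ℝ) : ℂ :=
  ch1 s a b t * (EE s a t - ee t) + ch0 s a b t * (ps1 s a t * EE s a t + ee t)
    + Complex.I * b * EE s a t + Complex.I * b * t * ps1 s a t * EE s a t
noncomputable def R2 (s a b t : ℝ) : ℂ :=
  ch2 s a b t * (EE s a t - ee t) + 2 * ch1 s a b t * (ps1 s a t * EE s a t + ee t)
    + ch0 s a b t * ((ps2 s a t + ps1 s a t ^ 2) * EE s a t - ee t)
    + 2 * Complex.I * b * ps1 s a t * EE s a t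
    + Complex.I * b * t * (ps2 s a t + ps1 s a t ^ 2) * EE s a t
noncomputable def R3 (s a b t : ℝ) : ℂ :=
  tch3 s a b t * (t : ℂ)⁻¹ * (EE s a t - ee t) + 3 * ch2 s a b t * (ps1 s a t * EE s a t + ee t)
    + 3 * ch1 s a b t * ((ps2 s a t + ps1 s a t ^ 2) * EE s a t - ee t)
    + ch0 s a b t * ((tps3 s a t * (t : ℂ)⁻¹ + 3 * ps1 s a t * ps2 s a t + ps1 s a t ^ 3) * EE s a t + ee t)
    + 3 * Complex.I * b * (ps2 s a t + ps1 s a t ^ 2) * EE s a t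
    + Complex.I * b * t * (tps3 s a t * (t : ℂ)⁻¹ + 3 * ps1 s a t * ps2 s a t + ps1 s a t ^ 3) * EE s a t

variable {s a b t : ℝ}

lemma hd_t : HasDerivAt (fun t : ℝ => (t : ℂ)) 1 t := by
  simpa using (hasDerivAt_id t).ofReal_comp

lemma hd_TT (ht : 0 < t) : HasDerivAt (TT s) (-s * TT s t * (t : ℂ)⁻¹) t := by
  have h := (Real.hasDerivAt_rpow_const (x := t) (p := -s) (Or.inl ht.ne')).ofReal_comp
  unfold TT
  convert h using 1
  rw [Real.rpow_sub ht, Real.rpow_one]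
  push_cast
  ring

lemma hd_LL (ht : 0 < t) : HasDerivAt LL ((t : ℂ)⁻¹) t := by
  have h := (Real.hasDerivAt_log ht.ne').ofReal_comp
  unfold LL
  convert h using 1
  push_cast; rfl

lemma hd_ps0 (ht : 0 < t) : HasDerivAt (ps0 s a) (ps1 s a t) t := by
  have hc : (t : ℂ) ≠ 0 := by exact_mod_cast ht.ne'
  have h := ((((hd_t (t := t)).pow 2).const_mul (-(cA a))).mul (hd_TT (s := s) ht)).add
    ((hd_t (t := t)).const_mul (Complex.I * a))
  refine h.congr_deriv ?_
  unfold ps1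
  field_simp
  simp
  ring

lemma hd_ps1 (ht : 0 < t) : HasDerivAt (ps1 s a) (ps2 s a t) t := by
  have hc : (t : ℂ) ≠ 0 := by exact_mod_cast ht.ne'
  have h := (((hd_t (t := t)).const_mul (-(cA a) * (2 - s))).mul (hd_TT (s := s) ht)).add_const
    (Complex.I * a)
  refine h.congr_deriv ?_
  unfold ps2
  field_simp
  ring

lemma hd_ps2 (ht : 0 < t) : HasDerivAt (ps2 s a) (tps3 s a t * (t : ℂ)⁻¹) t := by
  have h := (hd_TT (s := s) ht).const_mul (-(cA a) * (2 - s) * (1 - s))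
  refine h.congr_deriv ?_
  unfold tps3
  ring

lemma hd_ch0 (ht : 0 < t) : HasDerivAt (ch0 s a b) (ch1 s a b t) t := by
  have hc : (t : ℂ) ≠ 0 := by exact_mod_cast ht.ne'
  have h := (((((hd_t (t := t)).pow 2).const_mul (cA a)).mul (hd_TT (s := s) ht)).mul (hd_LL ht)).sub
    ((((hd_t (t := t)).pow 2).const_mul (Complex.I * b)).mul (hd_TT (s := s) ht))
  refine h.congr_deriv ?_
  unfold ch1
  simp only [Pi.mul_apply, Pi.pow_apply]
  field_simp
  simp
  ring

lemma hd_ch1 (ht : 0 < t) : HasDerivAt (ch1 s a b) (ch2 s a b t) t := by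
  have hc : (t : ℂ) ≠ 0 := by exact_mod_cast ht.ne'
  have h := ((((((hd_t (t := t)).const_mul (2 - (s:ℂ))).mul (hd_TT (s := s) ht)).mul (hd_LL ht)).add
    ((hd_t (t := t)).mul (hd_TT (s := s) ht))).const_mul (cA a)).sub
    (((hd_t (t := t)).const_mul (Complex.I * b * (2 - s))).mul (hd_TT (s := s) ht))
  refine h.congr_deriv ?_
  unfold ch2
  simp only [Pi.mul_apply, Pi.pow_apply]
  field_simp
  ring

lemma hd_ch2 (ht : 0 < t) : HasDerivAt (ch2 s a b) (tch3 s a b t * (t : ℂ)⁻¹) t := by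
  have hc : (t : ℂ) ≠ 0 := by exact_mod_cast ht.ne'
  have h := (((((hd_TT (s := s) ht).const_mul ((2 - (s:ℂ)) * (1 - s))).mul (hd_LL ht)).add
    ((hd_TT (s := s) ht).const_mul (3 - 2 * (s:ℂ)))).const_mul (cA a)).sub
    ((hd_TT (s := s) ht).const_mul (Complex.I * b * (2 - s) * (1 - s)))
  refine h.congr_deriv ?_
  unfold tch3
  field_simp
  ring

lemma hd_EE (ht : 0 < t) : HasDerivAt (EE s a) (ps1 s a t * EE s a t) t := by
  have h := (hd_ps0 (s := s) (a := a) ht).cexp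
  refine h.congr_deriv ?_
  unfold EE; ring

lemma hd_ee : HasDerivAt ee (-ee t) t := by
  have h := (hd_t (t := t)).neg.cexp
  refine h.congr_deriv ?_
  simp [ee]

lemma hd_R0 (ht : 0 < t) : HasDerivAt (R0 s a b) (R1 s a b t) t := by
  have h := ((hd_ch0 (s := s) (a := a) (b := b) ht).mul ((hd_EE (s := s) (a := a) ht).sub hd_ee)).add
    (((hd_t (t := t)).const_mul (Complex.I * b)).mul (hd_EE (s := s) (a := a) ht))
  refine h.congr_deriv ?_
  unfold R1
  simp only [Pi.mul_apply, Pi.sub_apply, Pi.pow_apply, Pi.add_apply]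
  ring

lemma hd_R1 (ht : 0 < t) : HasDerivAt (R1 s a b) (R2 s a b t) t := by
  have hE := hd_EE (s := s) (a := a) ht
  have he := hd_ee (t := t)
  have h0 := hd_ch0 (s := s) (a := a) (b := b) ht
  have h1 := hd_ch1 (s := s) (a := a) (b := b) ht
  have p1 := hd_ps1 (s := s) (a := a) ht
  have h := (((h1.mul (hE.sub he)).add (h0.mul ((p1.mul hE).add he))).add
    (hE.const_mul (Complex.I * b))).add
    ((((hd_t (t := t)).const_mul (Complex.I * b)).mul p1).mul hE)
  refine h.congr_deriv ?_
  unfold R2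
  simp only [Pi.mul_apply, Pi.sub_apply, Pi.pow_apply, Pi.add_apply]
  ring

lemma hd_R2 (ht : 0 < t) : HasDerivAt (R2 s a b) (R3 s a b t) t := by
  have hE := hd_EE (s := s) (a := a) ht
  have he := hd_ee (t := t)
  have h0 := hd_ch0 (s := s) (a := a) (b := b) ht
  have h1 := hd_ch1 (s := s) (a := a) (b := b) ht
  have h2 := hd_ch2 (s := s) (a := a) (b := b) ht
  have p1 := hd_ps1 (s := s) (a := a) ht
  have p2 := hd_ps2 (s := s) (a := a) ht
  have pp := p2.add (p1.pow 2)
  have h := ((((h2.mul (hE.sub he)).add ((h1.const_mul 2).mul ((p1.mul hE).add he))).add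
    (h0.mul ((pp.mul hE).sub he))).add
    ((p1.const_mul (2 * Complex.I * b)).mul hE)).add
    ((((hd_t (t := t)).const_mul (Complex.I * b)).mul pp).mul hE)
  refine h.congr_deriv ?_
  unfold R3
  simp only [Pi.mul_apply, Pi.sub_apply, Pi.pow_apply, Pi.add_apply]
  push_cast
  ring

end expansion

section bounds

/-- weight function -/
noncomputable def vv (t : ℝ) : ℝ := (1 + t) * (t ^ (-(1/32) : ℝ) + t ^ (1/32 : ℝ))

/-- uniform polynomial-type bound in the weight -/
def Bd (k : ℕ) (f : ℝ → ℝ → ℝ → ℝ → ℂ) : Prop :=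
  ∃ K : ℝ, 0 ≤ K ∧ ∀ s a b t : ℝ, |s| ≤ 1/32 → |a| ≤ 1 → |b| ≤ 4 → 0 < t →
    ‖f s a b t‖ ≤ K * vv t ^ k

lemma ww_ge (t : ℝ) (ht : 0 < t) : 1 ≤ t ^ (-(1/32) : ℝ) + t ^ (1/32 : ℝ) := by
  have h1 := Real.rpow_pos_of_pos ht (-(1/32))
  have h2 := Real.rpow_pos_of_pos ht (1/32)
  rcases le_total 1 t with h | h
  · have := Real.one_le_rpow h (show (0:ℝ) ≤ 1/32 by norm_num)
    linarith
  · have := Real.one_le_rpow_of_pos_of_le_one_of_nonpos ht h (show (-(1/32):ℝ) ≤ 0 by norm_num)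
    linarith

lemma ww_le_vv (t : ℝ) (ht : 0 < t) : t ^ (-(1/32) : ℝ) + t ^ (1/32 : ℝ) ≤ vv t := by
  unfold vv
  nlinarith [ww_ge t ht]

lemma vv_ge (t : ℝ) (ht : 0 < t) : 1 ≤ vv t := (ww_ge t ht).trans (ww_le_vv t ht)

lemma t_le_vv (t : ℝ) (ht : 0 < t) : t ≤ vv t := by
  unfold vv
  nlinarith [ww_ge t ht]

lemma Bd.mono {k l : ℕ} {f} (h : Bd k f) (hkl : k ≤ l) : Bd l f := by
  obtain ⟨K, hK, h⟩ := h
  refine ⟨K, hK, fun s a b t hs ha hb ht => (h s a b t hs ha hb ht).trans ?_⟩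
  have := vv_ge t ht
  gcongr

lemma Bd.add {k l : ℕ} {f g} (hf : Bd k f) (hg : Bd l g) :
    Bd (max k l) (fun s a b t => f s a b t + g s a b t) := by
  obtain ⟨K, hK, h⟩ := hf.mono (le_max_left k l)
  obtain ⟨K', hK', h'⟩ := hg.mono (le_max_right k l)
  refine ⟨K + K', by positivity, fun s a b t hs ha hb ht => ?_⟩
  refine (norm_add_le _ _).trans ?_
  rw [add_mul]
  exact add_le_add (h s a b t hs ha hb ht) (h' s a b t hs ha hb ht)

lemma Bd.neg {k : ℕ} {f} (hf : Bd k f) : Bd k (fun s a b t => -f s a b t) := by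
  obtain ⟨K, hK, h⟩ := hf
  exact ⟨K, hK, fun s a b t hs ha hb ht => by rw [norm_neg]; exact h s a b t hs ha hb ht⟩

lemma Bd.sub {k l : ℕ} {f g} (hf : Bd k f) (hg : Bd l g) :
    Bd (max k l) (fun s a b t => f s a b t - g s a b t) := by
  simpa [sub_eq_add_neg] using hf.add hg.neg

lemma Bd.mul {k l : ℕ} {f g} (hf : Bd k f) (hg : Bd l g) :
    Bd (k + l) (fun s a b t => f s a b t * g s a b t) := by
  obtain ⟨K, hK, h⟩ := hf
  obtain ⟨K', hK', h'⟩ := hg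
  refine ⟨K * K', by positivity, fun s a b t hs ha hb ht => ?_⟩
  rw [norm_mul]
  have := vv_ge t ht
  calc _ ≤ (K * vv t ^ k) * (K' * vv t ^ l) :=
        mul_le_mul (h s a b t hs ha hb ht) (h' s a b t hs ha hb ht) (norm_nonneg _) (by positivity)
    _ = _ := by ring

lemma Bd.pow2 {k : ℕ} {f} (hf : Bd k f) : Bd (k + k) (fun s a b t => f s a b t ^ 2) := by
  simpa [pow_two] using hf.mul hf

lemma Bd.pow3 {k : ℕ} {f} (hf : Bd k f) : Bd (k + k + k) (fun s a b t => f s a b t ^ 3) := by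
  have := (hf.mul hf).mul hf
  have e : (fun s a b t => f s a b t ^ 3) = (fun s a b t => f s a b t * f s a b t * f s a b t) := by
    funext s a b t; ring
  rw [e]; exact this

lemma Bd.congr {k : ℕ} {f g : ℝ → ℝ → ℝ → ℝ → ℂ} (hf : Bd k f)
    (h : ∀ s a b t : ℝ, 0 < t → g s a b t = f s a b t) : Bd k g := by
  obtain ⟨K, hK, hh⟩ := hf
  exact ⟨K, hK, fun s a b t hs ha hb ht => by rw [h s a b t ht]; exact hh s a b t hs ha hb ht⟩

lemma Bd.const (c : ℂ) : Bd 0 (fun _ _ _ _ => c) :=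
  ⟨‖c‖, norm_nonneg _, fun _ _ _ _ _ _ _ _ => by simp⟩

lemma Bd.s : Bd 0 (fun s _ _ _ => (s : ℂ)) :=
  ⟨1, by norm_num, fun s a b t hs ha hb ht => by simp; linarith⟩
lemma Bd.a : Bd 0 (fun _ a _ _ => (a : ℂ)) :=
  ⟨1, by norm_num, fun s a b t hs ha hb ht => by simp; linarith⟩
lemma Bd.b : Bd 0 (fun _ _ b _ => (b : ℂ)) :=
  ⟨4, by norm_num, fun s a b t hs ha hb ht => by simp; linarith⟩
lemma Bd.t : Bd 1 (fun _ _ _ t => (t : ℂ)) :=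
  ⟨1, by norm_num, fun s a b t hs ha hb ht => by
    simp [abs_of_pos ht]; exact t_le_vv t ht⟩
lemma Bd.TT : Bd 1 (fun s _ _ t => TT s t) :=
  ⟨1, by norm_num, fun s a b t hs ha hb ht => by
    unfold _root_.TT
    rw [Complex.norm_real, Real.norm_of_nonneg (by positivity), pow_one, one_mul]
    refine le_trans ?_ (ww_le_vv t ht)
    have h1 := Real.rpow_pos_of_pos ht (-(1/32))
    have h2 := Real.rpow_pos_of_pos ht (1/32)
    obtain ⟨h3, h4⟩ := abs_le.1 hs
    rcases le_total 1 t with h | h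
    · have := Real.rpow_le_rpow_of_exponent_le h (show -s ≤ 1/32 by linarith)
      linarith
    · have := Real.rpow_le_rpow_of_exponent_ge ht h (show -(1/32) ≤ -s by linarith)
      linarith⟩
lemma Bd.LL : Bd 1 (fun _ _ _ t => LL t) :=
  ⟨32, by norm_num, fun s a b t hs ha hb ht => by
    unfold _root_.LL
    rw [Complex.norm_real, Real.norm_eq_abs, pow_one]
    refine le_trans ?_ (mul_le_mul_of_nonneg_left (ww_le_vv t ht) (by norm_num))
    have h1 := Real.rpow_pos_of_pos ht (-(1/32))
    have h2 := Real.rpow_pos_of_pos ht (1/32)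
    have h3 := Real.log_le_rpow_div ht.le (show (0:ℝ) < 1/32 by norm_num)
    have h4 := Real.log_le_rpow_div (inv_pos.2 ht).le (show (0:ℝ) < 1/32 by norm_num)
    rw [Real.log_inv, Real.inv_rpow ht.le, ← Real.rpow_neg ht.le] at h4
    rw [abs_le]
    constructor <;> linarith⟩
lemma Bd.cA : Bd 0 (fun _ a _ _ => cA a) := (Bd.const 1).add ((Bd.const Complex.I).mul Bd.a)

lemma Bd.ps0t : Bd 2 (fun s a _ t => -(_root_.cA a) * t * _root_.TT s t + Complex.I * a) :=
  (((Bd.cA.neg.mul Bd.t).mul Bd.TT).add ((Bd.const Complex.I).mul Bd.a))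

lemma Bd.ps1 : Bd 2 (fun s a _ t => ps1 s a t) :=
  ((((Bd.cA.neg.mul ((Bd.const 2).sub Bd.s)).mul Bd.t).mul Bd.TT).add ((Bd.const Complex.I).mul Bd.a))
lemma Bd.ps2 : Bd 1 (fun s a _ t => ps2 s a t) :=
  (((Bd.cA.neg.mul ((Bd.const 2).sub Bd.s)).mul ((Bd.const 1).sub Bd.s)).mul Bd.TT)
lemma Bd.tps3 : Bd 1 (fun s a _ t => tps3 s a t) :=
  ((((Bd.cA.mul ((Bd.const 2).sub Bd.s)).mul ((Bd.const 1).sub Bd.s)).mul Bd.s).mul Bd.TT)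
lemma Bd.ch0 : Bd 4 (fun s a b t => ch0 s a b t) :=
  ((((Bd.cA.mul Bd.t.pow2).mul Bd.TT).mul Bd.LL).sub
    ((((Bd.const Complex.I).mul Bd.b).mul Bd.t.pow2).mul Bd.TT))
lemma Bd.ch0t : Bd 3 (fun s a b t => ch0t s a b t) :=
  ((((Bd.cA.mul Bd.t).mul Bd.TT).mul Bd.LL).sub
    ((((Bd.const Complex.I).mul Bd.b).mul Bd.t).mul Bd.TT))
lemma Bd.ch1 : Bd 3 (fun s a b t => ch1 s a b t) :=
  ((Bd.cA.mul ((((((Bd.const 2).sub Bd.s).mul Bd.t).mul Bd.TT).mul Bd.LL).add (Bd.t.mul Bd.TT))).sub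
    (((((Bd.const Complex.I).mul Bd.b).mul ((Bd.const 2).sub Bd.s)).mul Bd.t).mul Bd.TT))
lemma Bd.ch1t : Bd 2 (fun s a b t => ch1t s a b t) :=
  ((Bd.cA.mul (((((Bd.const 2).sub Bd.s).mul Bd.TT).mul Bd.LL).add Bd.TT)).sub
    ((((Bd.const Complex.I).mul Bd.b).mul ((Bd.const 2).sub Bd.s)).mul Bd.TT))
lemma Bd.ch2 : Bd 2 (fun s a b t => ch2 s a b t) :=
  ((Bd.cA.mul ((((((Bd.const 2).sub Bd.s).mul ((Bd.const 1).sub Bd.s)).mul Bd.TT).mul Bd.LL).add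
      (((Bd.const 3).sub ((Bd.const 2).mul Bd.s)).mul Bd.TT))).sub
    (((((Bd.const Complex.I).mul Bd.b).mul ((Bd.const 2).sub Bd.s)).mul ((Bd.const 1).sub Bd.s)).mul Bd.TT))
lemma Bd.tch3 : Bd 2 (fun s a b t => tch3 s a b t) :=
  ((Bd.cA.mul (((((Bd.s.neg.mul ((Bd.const 2).sub Bd.s)).mul ((Bd.const 1).sub Bd.s)).mul Bd.TT).mul Bd.LL).add
      ((((Bd.const 2).sub ((Bd.const 6).mul Bd.s)).add ((Bd.const 3).mul Bd.s.pow2)).mul Bd.TT))).add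
    ((((((Bd.const Complex.I).mul Bd.b).mul ((Bd.const 2).sub Bd.s)).mul ((Bd.const 1).sub Bd.s)).mul Bd.s).mul Bd.TT))

lemma ps0_re (s a t : ℝ) (ht : 0 < t) : (ps0 s a t).re = -(t ^ (2 - s)) := by
  have : t ^ (2 - s) = t ^ 2 * t ^ (-s) := by
    rw [sub_eq_add_neg, Real.rpow_add ht]; norm_num
  unfold ps0 TT cA
  rw [this]
  simp [pow_two]

lemma ps0_eq (s a t : ℝ) : ps0 s a t = t * (-(cA a) * t * TT s t + Complex.I * a) := by
  unfold ps0; ring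

lemma ps0_re_le0 (s a t : ℝ) (ht : 0 < t) : (ps0 s a t).re ≤ 0 := by
  rw [ps0_re s a t ht]; have := Real.rpow_pos_of_pos ht (2 - s); linarith

lemma ps0_re_le (s a t : ℝ) (hs : |s| ≤ 1/32) (ht : 0 < t) : (ps0 s a t).re ≤ 1 - t := by
  rw [ps0_re s a t ht]
  obtain ⟨h3, h4⟩ := abs_le.1 hs
  rcases le_total 1 t with h | h
  · have := Real.rpow_le_rpow_of_exponent_le h (show 1 ≤ 2 - s by linarith)
    rw [Real.rpow_one] at this; linarith
  · have := Real.rpow_pos_of_pos ht (2 - s); linarith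

lemma exp_diff_le (z w : ℂ) (c : ℝ) (hz : z.re ≤ c) (hw : w.re ≤ c) :
    ‖Complex.exp z - Complex.exp w‖ ≤ Real.exp c * ‖z - w‖ := by
  have hconv : Convex ℝ {z : ℂ | z.re ≤ c} := convex_halfSpace_re_le c
  refine hconv.norm_image_sub_le_of_norm_hasDerivWithin_le (f := Complex.exp) (f' := Complex.exp)
    (fun x _ => (Complex.hasDerivAt_exp x).hasDerivWithinAt) ?_ hw hz
  intro x hx
  rw [Complex.norm_exp]
  exact Real.exp_le_exp.2 hx

lemma Bd.EE : Bd 0 (fun s a _ t => EE s a t) :=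
  ⟨1, by norm_num, fun s a b t hs ha hb ht => by
    unfold _root_.EE
    rw [Complex.norm_exp]
    simpa using ps0_re_le0 s a t ht⟩
lemma Bd.ee : Bd 0 (fun _ _ _ t => ee t) :=
  ⟨1, by norm_num, fun s a b t hs ha hb ht => by
    unfold _root_.ee
    rw [Complex.norm_exp]
    simpa using ht.le⟩
/-- `e^t E` is bounded -/
lemma Bd.EEt : Bd 0 (fun s a _ t => _root_.EE s a t * Complex.exp t) :=
  ⟨Real.exp 1, by positivity, fun s a b t hs ha hb ht => by
    change ‖Complex.exp (ps0 s a t) * Complex.exp t‖ ≤ _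
    rw [← Complex.exp_add, Complex.norm_exp]
    have := ps0_re_le s a t hs ht
    simp only [pow_zero, mul_one, Complex.add_re, Complex.ofReal_re, Real.exp_le_exp]
    linarith⟩
/-- `e^t (E - e^{-t})/t` is bounded -/
lemma Bd.DD : Bd 2 (fun s a _ t => (_root_.EE s a t - _root_.ee t) * Complex.exp t * (t : ℂ)⁻¹) := by
  obtain ⟨K, hK, h⟩ := Bd.ps0t.add (Bd.const 1)
  refine ⟨Real.exp 1 * K, by positivity, fun s a b t hs ha hb ht => ?_⟩
  have h1 := h s a b t hs ha hb ht
  have h2 := exp_diff_le (ps0 s a t) (-(t:ℂ)) (1 - t) (ps0_re_le s a t hs ht) (by simp)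
  have e : ps0 s a t - -(t:ℂ) = t * (-(_root_.cA a) * t * _root_.TT s t + Complex.I * a + 1) := by
    rw [ps0_eq]; ring
  rw [e, norm_mul, Complex.norm_real, Real.norm_of_nonneg ht.le] at h2
  have e3 : ‖Complex.exp (t:ℂ)‖ = Real.exp t := by rw [Complex.norm_exp]; simp
  rw [norm_mul, norm_mul, norm_inv, Complex.norm_real, Real.norm_of_nonneg ht.le, e3]
  unfold _root_.EE _root_.ee
  calc _ ≤ (Real.exp (1 - t) * (t * (K * vv t ^ max 2 0))) * Real.exp t * t⁻¹ := by
        gcongr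
        refine h2.trans ?_
        gcongr
    _ = (Real.exp (1 - t) * Real.exp t) * K * vv t ^ 2 * (t * t⁻¹) := by
        rw [show max 2 0 = 2 from rfl]; ring
    _ = _ := by
        rw [← Real.exp_add, mul_inv_cancel₀ ht.ne']; simp
lemma Bd.DD1 : Bd 2 (fun s a _ t => (_root_.EE s a t - _root_.ee t) * (t : ℂ)⁻¹) := by
  refine Bd.congr (Bd.DD.mul Bd.ee) ?_
  intro s a b t ht
  have : Complex.exp (t:ℂ) * _root_.ee t = 1 := by
    unfold _root_.ee; rw [← Complex.exp_add]; simp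
  linear_combination (-(_root_.EE s a t - _root_.ee t) * (t : ℂ)⁻¹) * this
lemma Bd.NN : Bd 2 (fun s a _ t => (_root_.EE s a t - 1) * (t : ℂ)⁻¹) := by
  obtain ⟨K, hK, h⟩ := Bd.ps0t
  refine ⟨K, by positivity, fun s a b t hs ha hb ht => ?_⟩
  have h1 := h s a b t hs ha hb ht
  have h2 := exp_diff_le (ps0 s a t) 0 0 (ps0_re_le0 s a t ht) (by simp)
  rw [sub_zero, ps0_eq, norm_mul, Complex.norm_real, Real.norm_of_nonneg ht.le, ← ps0_eq] at h2
  rw [norm_mul, norm_inv, Complex.norm_real, Real.norm_of_nonneg ht.le]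
  unfold _root_.EE
  rw [Complex.exp_zero, Real.exp_zero, one_mul] at h2
  calc _ ≤ (t * (K * vv t ^ 2)) * t⁻¹ := by
        gcongr
        refine h2.trans ?_
        gcongr
    _ = _ := by field_simp

end bounds

section bounds3

lemma ee_mul_exp (t : ℝ) : ee t * Complex.exp (t:ℂ) = 1 := by
  unfold ee; rw [← Complex.exp_add]; simp

lemma ii_mul {t : ℝ} (ht : 0 < t) : (t:ℂ) * (t:ℂ)⁻¹ = 1 :=
  mul_inv_cancel₀ (by exact_mod_cast ht.ne')

lemma Bd.G : Bd 16 (fun s a b t =>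
    ((_root_.ch0 s a b t + Complex.I * b * t) * _root_.EE s a t) * Complex.exp t) := by
  refine (((Bd.ch0.add (((Bd.const Complex.I).mul Bd.b).mul Bd.t)).mul Bd.EEt).mono
    (by norm_num)).congr ?_
  intro s a b t ht
  ring

lemma Bd.cee : Bd 16 (fun s a b t => (_root_.ch0 s a b t * _root_.ee t) * Complex.exp t) := by
  refine (Bd.ch0.mono (by norm_num)).congr ?_
  intro s a b t ht
  rw [mul_assoc, ee_mul_exp, mul_one]

lemma Bd.R0 : Bd 16 (fun s a b t => _root_.R0 s a b t * Complex.exp t) := by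
  refine (((Bd.ch0.mul (Bd.EEt.sub (Bd.const 1))).add
    ((((Bd.const Complex.I).mul Bd.b).mul Bd.t).mul Bd.EEt)).mono (by norm_num)).congr ?_
  intro s a b t ht
  unfold _root_.R0
  linear_combination (-_root_.ch0 s a b t) * ee_mul_exp t

lemma Bd.R1 : Bd 16 (fun s a b t => _root_.R1 s a b t * Complex.exp t) := by
  refine (((((Bd.ch1.mul (Bd.EEt.sub (Bd.const 1))).add
    (Bd.ch0.mul ((Bd.ps1.mul Bd.EEt).add (Bd.const 1)))).add
    (((Bd.const Complex.I).mul Bd.b).mul Bd.EEt)).add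
    (((((Bd.const Complex.I).mul Bd.b).mul Bd.t).mul Bd.ps1).mul Bd.EEt)).mono
      (by norm_num)).congr ?_
  intro s a b t ht
  unfold _root_.R1
  linear_combination (-_root_.ch1 s a b t + _root_.ch0 s a b t) * ee_mul_exp t

lemma Bd.R2 : Bd 16 (fun s a b t => _root_.R2 s a b t * Complex.exp t) := by
  refine ((((((Bd.ch2.mul (Bd.EEt.sub (Bd.const 1))).add
    (((Bd.const 2).mul Bd.ch1).mul ((Bd.ps1.mul Bd.EEt).add (Bd.const 1)))).add
    (Bd.ch0.mul (((Bd.ps2.add Bd.ps1.pow2).mul Bd.EEt).sub (Bd.const 1)))).add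
    ((((Bd.const (2 * Complex.I)).mul Bd.b).mul Bd.ps1).mul Bd.EEt)).add
    (((((Bd.const Complex.I).mul Bd.b).mul Bd.t).mul (Bd.ps2.add Bd.ps1.pow2)).mul Bd.EEt)).mono
      (by norm_num)).congr ?_
  intro s a b t ht
  unfold _root_.R2
  linear_combination (-_root_.ch2 s a b t + 2 * _root_.ch1 s a b t - _root_.ch0 s a b t)
    * ee_mul_exp t

lemma Bd.R3 : Bd 16 (fun s a b t => _root_.R3 s a b t * Complex.exp t) := by
  refine ((((((((Bd.tch3.mul Bd.DD).add
    (((Bd.const 3).mul Bd.ch2).mul ((Bd.ps1.mul Bd.EEt).add (Bd.const 1)))).add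
    (((Bd.const 3).mul Bd.ch1).mul (((Bd.ps2.add Bd.ps1.pow2).mul Bd.EEt).sub (Bd.const 1)))).add
    ((Bd.ch0t.mul Bd.tps3).mul Bd.EEt)).add
    (Bd.ch0.mul (((((Bd.const 3).mul Bd.ps1).mul Bd.ps2).add Bd.ps1.pow3).mul Bd.EEt |>.add
      (Bd.const 1)))).add
    ((((Bd.const (3 * Complex.I)).mul Bd.b).mul (Bd.ps2.add Bd.ps1.pow2)).mul Bd.EEt)).add
    ((((Bd.const Complex.I).mul Bd.b).mul (Bd.tps3.add (Bd.t.mul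
      ((((Bd.const 3).mul Bd.ps1).mul Bd.ps2).add Bd.ps1.pow3)))).mul Bd.EEt)).mono
      (by norm_num)).congr ?_
  intro s a b t ht
  have e0 : _root_.ch0 s a b t = t * _root_.ch0t s a b t := by
    unfold _root_.ch0 _root_.ch0t; ring
  unfold _root_.R3
  linear_combination (3 * _root_.ch2 s a b t - 3 * _root_.ch1 s a b t + _root_.ch0 s a b t)
    * ee_mul_exp t + (_root_.tps3 s a t * (t:ℂ)⁻¹ * _root_.EE s a t * Complex.exp t) * e0 +
    (_root_.ch0t s a b t + Complex.I * b) * _root_.tps3 s a t * _root_.EE s a t * Complex.exp t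
      * ii_mul ht

/-- remainders at the origin -/
lemma Bd.R0z : Bd 16 (fun s a b t => _root_.R0 s a b t * (t:ℂ)⁻¹) := by
  refine (((Bd.ch0t.mul (Bd.EE.sub Bd.ee)).add
    (((Bd.const Complex.I).mul Bd.b).mul Bd.EE)).mono (by norm_num)).congr ?_
  intro s a b t ht
  have e0 : _root_.ch0 s a b t = t * _root_.ch0t s a b t := by
    unfold _root_.ch0 _root_.ch0t; ring
  unfold _root_.R0
  linear_combination ((_root_.EE s a t - _root_.ee t) * (t:ℂ)⁻¹) * e0 +
    (_root_.ch0t s a b t * (_root_.EE s a t - _root_.ee t) + Complex.I * b * _root_.EE s a t)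
      * ii_mul ht

lemma Bd.R1z : Bd 16 (fun s a b t => (_root_.R1 s a b t - Complex.I * b) * (t:ℂ)⁻¹) := by
  refine (((((Bd.ch1.mul Bd.DD1).add (Bd.ch0t.mul ((Bd.ps1.mul Bd.EE).add Bd.ee))).add
    (((Bd.const Complex.I).mul Bd.b).mul Bd.NN)).add
    ((((Bd.const Complex.I).mul Bd.b).mul Bd.ps1).mul Bd.EE)).mono (by norm_num)).congr ?_
  intro s a b t ht
  have e0 : _root_.ch0 s a b t = t * _root_.ch0t s a b t := by
    unfold _root_.ch0 _root_.ch0t; ring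
  unfold _root_.R1
  linear_combination ((_root_.ps1 s a t * _root_.EE s a t + _root_.ee t) * (t:ℂ)⁻¹) * e0 +
    (_root_.ch0t s a b t * (_root_.ps1 s a t * _root_.EE s a t + _root_.ee t)
      + Complex.I * b * _root_.ps1 s a t * _root_.EE s a t) * ii_mul ht

lemma Bd.R2z : Bd 16 (fun s a b t => (_root_.R2 s a b t + 2 * a * b) * (t:ℂ)⁻¹) := by
  refine ((((((Bd.ch2.mul Bd.DD1).add
    (((Bd.const 2).mul Bd.ch1t).mul ((Bd.ps1.mul Bd.EE).add Bd.ee))).add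
    (Bd.ch0t.mul (((Bd.ps2.add Bd.ps1.pow2).mul Bd.EE).sub Bd.ee))).add
    (((Bd.const (2 * Complex.I)).mul Bd.b).mul
      ((((Bd.cA.neg.mul ((Bd.const 2).sub Bd.s)).mul Bd.TT).mul Bd.EE).add
        (((Bd.const Complex.I).mul Bd.a).mul Bd.NN)))).add
    ((((Bd.const Complex.I).mul Bd.b).mul (Bd.ps2.add Bd.ps1.pow2)).mul Bd.EE)).mono
      (by norm_num)).congr ?_
  intro s a b t ht
  have e0 : _root_.ch0 s a b t = t * _root_.ch0t s a b t := by
    unfold _root_.ch0 _root_.ch0t; ring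
  have e1 : _root_.ch1 s a b t = t * _root_.ch1t s a b t := by
    unfold _root_.ch1 _root_.ch1t; ring
  have e2 : _root_.ps1 s a t = t * (-(_root_.cA a) * (2 - s) * _root_.TT s t) + Complex.I * a := by
    unfold _root_.ps1; ring
  have e3 := Complex.I_sq
  unfold _root_.R2
  linear_combination
    (((_root_.ps2 s a t + _root_.ps1 s a t ^ 2) * _root_.EE s a t - _root_.ee t) * (t:ℂ)⁻¹) * e0 +
    (2 * (_root_.ps1 s a t * _root_.EE s a t + _root_.ee t) * (t:ℂ)⁻¹) * e1 +
    (2 * Complex.I * b * _root_.EE s a t * (t:ℂ)⁻¹) * e2 + 2 * a * b * (t:ℂ)⁻¹ * e3 +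
    (_root_.ch0t s a b t * ((_root_.ps2 s a t + _root_.ps1 s a t ^ 2) * _root_.EE s a t
        - _root_.ee t) + 2 * _root_.ch1t s a b t * (_root_.ps1 s a t * _root_.EE s a t + _root_.ee t)
      + Complex.I * b * (_root_.ps2 s a t + _root_.ps1 s a t ^ 2) * _root_.EE s a t
      + 2 * Complex.I * b * (-(_root_.cA a) * (2 - s) * _root_.TT s t) * _root_.EE s a t)
      * ii_mul ht

lemma vv16_le (t : ℝ) (ht : 0 < t) :
    vv t ^ 16 ≤ 4 ^ 16 * (t ^ (-(1/2) : ℝ) + t ^ (32:ℕ)) := by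
  have h1 := Real.rpow_pos_of_pos ht (-(1/32))
  have h2 := Real.rpow_pos_of_pos ht (1/32)
  have h12 := Real.rpow_pos_of_pos ht (-(1/2))
  rcases le_total 1 t with h | h
  · have a1 : t ^ (-(1/32) : ℝ) ≤ t := by
      simpa using Real.rpow_le_rpow_of_exponent_le h (show (-(1/32) : ℝ) ≤ 1 by norm_num)
    have a2 : t ^ (1/32 : ℝ) ≤ t := by
      simpa using Real.rpow_le_rpow_of_exponent_le h (show (1/32 : ℝ) ≤ 1 by norm_num)
    have : vv t ≤ 4 * t ^ 2 := by
      unfold vv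
      nlinarith
    calc vv t ^ 16 ≤ (4 * t ^ 2) ^ 16 := by
          have := vv_ge t ht
          gcongr
      _ = 4 ^ 16 * t ^ 32 := by ring
      _ ≤ _ := by
          have : 0 < t ^ 32 := by positivity
          nlinarith
  · have a2 : t ^ (1/32 : ℝ) ≤ t ^ (-(1/32) : ℝ) :=
      Real.rpow_le_rpow_of_exponent_ge ht h (by norm_num)
    have : vv t ≤ 4 * t ^ (-(1/32) : ℝ) := by
      unfold vv
      nlinarith
    have e : (t ^ (-(1/32) : ℝ)) ^ 16 = t ^ (-(1/2) : ℝ) := by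
      rw [← Real.rpow_natCast, ← Real.rpow_mul ht.le]; norm_num
    calc vv t ^ 16 ≤ (4 * t ^ (-(1/32) : ℝ)) ^ 16 := by
          have := vv_ge t ht
          gcongr
      _ = 4 ^ 16 * t ^ (-(1/2) : ℝ) := by rw [mul_pow, e]
      _ ≤ _ := by
          have : 0 < t ^ 32 := by positivity
          nlinarith

/-- the dominating function -/
noncomputable def dm (t : ℝ) : ℝ := (t ^ (-(1/2) : ℝ) + t ^ (32:ℕ)) * Real.exp (-t)

lemma dm_int : IntegrableOn dm (Ioi 0) := by
  have h1 := Real.GammaIntegral_convergent (show (0:ℝ) < 1/2 by norm_num)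
  have h2 := Real.GammaIntegral_convergent (show (0:ℝ) < 33 by norm_num)
  refine (h1.add h2).congr_fun ?_ measurableSet_Ioi
  intro t ht
  have e : t ^ ((33:ℝ) - 1) = t ^ (32:ℕ) := by
    rw [← Real.rpow_natCast]; norm_num
  simp only [Pi.add_apply, e]
  unfold dm
  norm_num
  ring

lemma Bd.dom {f : ℝ → ℝ → ℝ → ℝ → ℂ} (h : Bd 16 (fun s a b t => f s a b t * Complex.exp t)) :
    ∃ K : ℝ, 0 ≤ K ∧ ∀ s a b t : ℝ, |s| ≤ 1/32 → |a| ≤ 1 → |b| ≤ 4 → 0 < t →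
      ‖f s a b t‖ ≤ K * dm t := by
  obtain ⟨K, hK, h⟩ := h
  refine ⟨K * 4 ^ 16, by positivity, fun s a b t hs ha hb ht => ?_⟩
  have h1 := h s a b t hs ha hb ht
  have e3 : ‖Complex.exp (t:ℂ)‖ = Real.exp t := by rw [Complex.norm_exp]; simp
  rw [norm_mul, e3] at h1
  have h2 := vv16_le t ht
  have h3 : ‖f s a b t‖ * Real.exp t ≤ K * (4 ^ 16 * (t ^ (-(1/2) : ℝ) + t ^ (32:ℕ))) :=
    h1.trans (by gcongr)
  have h4 := mul_le_mul_of_nonneg_right h3 (Real.exp_pos (-t)).le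
  rw [mul_assoc, ← Real.exp_add, add_neg_cancel, Real.exp_zero, mul_one] at h4
  refine h4.trans (le_of_eq ?_)
  unfold dm; ring

lemma Bd.lim {f : ℝ → ℝ → ℝ → ℝ → ℂ} (h : Bd 16 (fun s a b t => f s a b t * (t:ℂ)⁻¹))
    {s a b : ℝ} (hs : |s| ≤ 1/32) (ha : |a| ≤ 1) (hb : |b| ≤ 4) :
    Tendsto (f s a b) (𝓝[>] 0) (𝓝 0) := by
  obtain ⟨K, hK, h⟩ := h
  have hl : Tendsto (fun t : ℝ => K * (4 ^ 16 * (t ^ (1/2 : ℝ) + t ^ (33:ℕ)))) (𝓝[>] 0) (𝓝 0) := by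
    have : ContinuousAt (fun t : ℝ => K * (4 ^ 16 * (t ^ (1/2 : ℝ) + t ^ (33:ℕ)))) 0 := by
      have := Real.continuousAt_rpow_const 0 (1/2) (Or.inr (by norm_num))
      fun_prop
    have h2 := this.tendsto.mono_left (nhdsWithin_le_nhds (s := Ioi 0))
    simpa using h2
  refine squeeze_zero_norm' ?_ hl
  filter_upwards [self_mem_nhdsWithin] with t ht
  have ht : 0 < t := ht
  have h1 := h s a b t hs ha hb ht
  have h2 := vv16_le t ht
  rw [norm_mul, norm_inv, Complex.norm_real, Real.norm_of_nonneg ht.le] at h1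
  have h3 : ‖f s a b t‖ * t⁻¹ ≤ K * (4 ^ 16 * (t ^ (-(1/2) : ℝ) + t ^ (32:ℕ))) :=
    h1.trans (by gcongr)
  have h4 := mul_le_mul_of_nonneg_right h3 ht.le
  rw [mul_assoc, inv_mul_cancel₀ ht.ne', mul_one] at h4
  refine h4.trans (le_of_eq ?_)
  have : t ^ (1/2 : ℝ) = t ^ (-(1/2) : ℝ) * t := by
    nth_rewrite 3 [← Real.rpow_one t]
    rw [← Real.rpow_add ht]; norm_num
  rw [this]; ring

end bounds3

section fourier

/-- half-line Fourier integral -/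
noncomputable def ft (x : ℝ) (F : ℝ → ℂ) : ℂ :=
  ∫ t in Ioi (0:ℝ), Complex.exp (-(Complex.I * (t:ℂ) * (x:ℂ))) * F t

lemma norm_ker (t x : ℝ) : ‖Complex.exp (-(Complex.I * (t:ℂ) * (x:ℂ)))‖ = 1 := by
  rw [Complex.norm_exp]; simp

lemma meas_ker (x : ℝ) : Measurable (fun t : ℝ => Complex.exp (-(Complex.I * (t:ℂ) * (x:ℂ)))) := by
  fun_prop

lemma ker_int {F : ℝ → ℂ} (x : ℝ) (hF : IntegrableOn F (Ioi 0)) :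
    IntegrableOn (fun t : ℝ => Complex.exp (-(Complex.I * (t:ℂ) * (x:ℂ))) * F t) (Ioi 0) := by
  refine Integrable.bdd_mul (c := 1) hF (meas_ker x).aestronglyMeasurable ?_
  exact Eventually.of_forall (fun t => (norm_ker t x).le)

lemma ft_norm_le {F : ℝ → ℂ} (x : ℝ) : ‖ft x F‖ ≤ ∫ t in Ioi (0:ℝ), ‖F t‖ := by
  unfold ft
  refine (norm_integral_le_integral_norm _).trans (le_of_eq ?_)
  congr 1
  funext t
  rw [norm_mul, norm_ker, one_mul]

lemma ft_add {F G : ℝ → ℂ} (x : ℝ) (hF : IntegrableOn F (Ioi 0)) (hG : IntegrableOn G (Ioi 0)) :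
    ft x (fun t => F t + G t) = ft x F + ft x G := by
  unfold ft
  rw [← integral_add (ker_int x hF) (ker_int x hG)]
  congr 1; funext t; ring

lemma ft_ibp0 {F F' : ℝ → ℂ} {L : ℂ} (x : ℝ)
    (hd : ∀ t ∈ Ioi (0:ℝ), HasDerivAt F (F' t) t)
    (hF : IntegrableOn F (Ioi 0)) (hF' : IntegrableOn F' (Ioi 0))
    (h0 : Tendsto F (𝓝[>] 0) (𝓝 L)) :
    ft x F * (Complex.I * x) = L + ft x F' := by
  have hk : ∀ t : ℝ, HasDerivAt (fun t : ℝ => Complex.exp (-(Complex.I * (t:ℂ) * (x:ℂ))))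
      (-(Complex.I * x) * Complex.exp (-(Complex.I * (t:ℂ) * (x:ℂ)))) t := by
    intro t
    have h := (((hd_t (t := t)).const_mul Complex.I).mul_const (x:ℂ)).neg.cexp
    refine h.congr_deriv ?_
    simp only [Pi.neg_apply]
    ring
  have hinf := tendsto_zero_of_hasDerivAt_of_integrableOn_Ioi hd hF' hF
  have i1 := ker_int x hF'
  have i2 := (ker_int x hF).const_mul (-(Complex.I * x))
  have key := integral_Ioi_mul_deriv_eq_deriv_mul (a := (0:ℝ)) (a' := L) (b' := 0)
    (u := fun t : ℝ => Complex.exp (-(Complex.I * (t:ℂ) * (x:ℂ)))) (v := F)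
    (u' := fun t : ℝ => -(Complex.I * x) * Complex.exp (-(Complex.I * (t:ℂ) * (x:ℂ)))) (v' := F')
    (fun t _ => hk t) hd i1 ?_ ?_ ?_
  · have e : ∫ (t : ℝ) in Ioi 0, -(Complex.I * x) * Complex.exp (-(Complex.I * (t:ℂ) * (x:ℂ))) * F t
        = -(Complex.I * x) * ft x F := by
      unfold ft
      rw [← integral_const_mul]
      congr 1; funext t; ring
    rw [e] at key
    have key' : ft x F' = 0 - L - -(Complex.I * x) * ft x F := key
    rw [key']; ring
  · refine i2.congr (Eventually.of_forall (fun t => ?_))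
    simp only [Pi.mul_apply]; ring
  · have hc : Tendsto (fun t : ℝ => Complex.exp (-(Complex.I * (t:ℂ) * (x:ℂ)))) (𝓝[>] 0) (𝓝 1) := by
      have := (hk 0).continuousAt.tendsto.mono_left (nhdsWithin_le_nhds (s := Ioi 0))
      simpa using this
    have := hc.mul h0
    rw [one_mul] at this
    exact this
  · rw [tendsto_zero_iff_norm_tendsto_zero] at hinf ⊢
    refine hinf.congr (fun t => ?_)
    simp only [Pi.mul_apply, norm_mul, norm_ker, one_mul]

lemma ft_ibp {F F' : ℝ → ℂ} {L : ℂ} {x : ℝ} (hx : x ≠ 0)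
    (hd : ∀ t ∈ Ioi (0:ℝ), HasDerivAt F (F' t) t)
    (hF : IntegrableOn F (Ioi 0)) (hF' : IntegrableOn F' (Ioi 0))
    (h0 : Tendsto F (𝓝[>] 0) (𝓝 L)) :
    ft x F = (L + ft x F') / (Complex.I * x) := by
  have hx' : Complex.I * (x:ℂ) ≠ 0 := by simp [hx]
  rw [eq_div_iff hx']
  exact ft_ibp0 x hd hF hF' h0

lemma ft_rl (g : ℝ → ℂ) : Tendsto (fun x => ft x g) atTop (𝓝 0) := by
  have h := Real.tendsto_integral_exp_smul_cocompact ((Ioi (0:ℝ)).indicator g)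
  have h2 : Tendsto (fun x : ℝ => x / (2 * π)) atTop (cocompact ℝ) :=
    (tendsto_id.atTop_div_const (by positivity)).mono_right atTop_le_cocompact
  refine (h.comp h2).congr (fun x => ?_)
  unfold ft
  simp only [Function.comp]
  rw [← integral_indicator measurableSet_Ioi]
  congr 1; funext t
  by_cases ht : t ∈ Ioi (0:ℝ)
  · rw [indicator_of_mem ht, indicator_of_mem ht]
    rw [Circle.smul_def, Real.fourierChar_apply, smul_eq_mul]
    congr 2
    push_cast
    have : (π:ℂ) ≠ 0 := by exact_mod_cast Real.pi_ne_zero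
    field_simp
  · rw [indicator_of_notMem ht, indicator_of_notMem ht]; simp

lemma ft_joint (F : ℝ → ℝ → ℂ) (bd : ℝ → ℝ) (hbd : IntegrableOn bd (Ioi 0))
    (hm : ∀ s, Measurable (F s))
    (hF : ∀ᶠ s in 𝓝 (0:ℝ), ∀ t, 0 < t → ‖F s t‖ ≤ bd t)
    (hc : ∀ t, 0 < t → ContinuousAt (fun s => F s t) 0) :
    Tendsto (fun q : ℝ × ℝ => ft q.2 (F q.1)) (𝓝 0 ×ˢ atTop) (𝓝 0) := by
  have hInteg : ∀ s, (∀ t, 0 < t → ‖F s t‖ ≤ bd t) → IntegrableOn (F s) (Ioi 0) := fun s h =>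
    Integrable.mono' hbd (hm s).aestronglyMeasurable
      ((ae_restrict_iff' measurableSet_Ioi).2 (Eventually.of_forall h))
  have h00 := hF.self_of_nhds
  have h0 := hInteg 0 h00
  have hl1 : Tendsto (fun s => ∫ t in Ioi (0:ℝ), ‖F s t - F 0 t‖) (𝓝 0) (𝓝 0) := by
    have : Tendsto (fun s => ∫ t in Ioi (0:ℝ), ‖F s t - F 0 t‖) (𝓝 0)
        (𝓝 (∫ t in Ioi (0:ℝ), (0:ℝ))) := by
      refine tendsto_integral_filter_of_dominated_convergence (fun t => bd t + bd t) ?_ ?_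
        (hbd.add hbd) ?_
      · exact Eventually.of_forall (fun s => ((hm s).sub (hm 0)).norm.aestronglyMeasurable)
      · filter_upwards [hF] with s hs
        refine (ae_restrict_iff' measurableSet_Ioi).2 (Eventually.of_forall (fun t ht => ?_))
        rw [norm_norm]
        exact (norm_sub_le _ _).trans (add_le_add (hs t ht) (h00 t ht))
      · refine (ae_restrict_iff' measurableSet_Ioi).2 (Eventually.of_forall (fun t ht => ?_))
        have := ((hc t ht).sub (continuousAt_const (y := F 0 t))).norm
        have h2 := this.tendsto
        simpa using h2
    simpa using this
  have A : Tendsto (fun q : ℝ × ℝ => ft q.2 (F 0)) (𝓝 0 ×ˢ atTop) (𝓝 0) :=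
    (ft_rl (F 0)).comp tendsto_snd
  have B : Tendsto (fun q : ℝ × ℝ => ft q.2 (fun t => F q.1 t - F 0 t)) (𝓝 0 ×ˢ atTop) (𝓝 0) := by
    refine squeeze_zero_norm (fun q => ft_norm_le q.2) (hl1.comp tendsto_fst)
  have AB := A.add B
  rw [add_zero] at AB
  refine AB.congr' ?_
  filter_upwards [tendsto_fst.eventually hF] with q hq
  have h3 : IntegrableOn (fun t => F q.1 t - F 0 t) (Ioi 0) := (hInteg q.1 hq).sub h0
  rw [← ft_add q.2 h0 h3]
  congr 1; funext t; ring

lemma meas_TT (s : ℝ) : Measurable (TT s) := by unfold TT; fun_prop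
lemma meas_LL : Measurable LL := by unfold LL; fun_prop
lemma meas_ps0 (s a : ℝ) : Measurable (ps0 s a) := by
  have := meas_TT s
  unfold ps0; fun_prop
lemma meas_EE (s a : ℝ) : Measurable (EE s a) := by
  have := meas_ps0 s a
  unfold EE; fun_prop
lemma meas_ee : Measurable ee := by unfold ee; fun_prop
lemma meas_ch0 (s a b : ℝ) : Measurable (ch0 s a b) := by
  have := meas_TT s
  have := meas_LL
  unfold ch0; fun_prop
lemma meas_R (s a b : ℝ) : Measurable (R0 s a b) ∧ Measurable (R1 s a b) ∧ Measurable (R2 s a b) ∧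
    Measurable (R3 s a b) := by
  have := meas_TT s
  have := meas_LL
  have := meas_EE s a
  have := meas_ee
  have := meas_ch0 s a b
  have h1 : Measurable (ch1 s a b) := by unfold ch1; fun_prop
  have h2 : Measurable (ch2 s a b) := by unfold ch2; fun_prop
  have h3 : Measurable (tch3 s a b) := by unfold tch3; fun_prop
  have p1 : Measurable (ps1 s a) := by unfold ps1; fun_prop
  have p2 : Measurable (ps2 s a) := by unfold ps2; fun_prop
  have p3 : Measurable (tps3 s a) := by unfold tps3; fun_prop
  refine ⟨?_, ?_, ?_, ?_⟩
  · unfold R0; fun_prop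
  · unfold R1; fun_prop
  · unfold R2; fun_prop
  · unfold R3; fun_prop

lemma cont_R3 {a b : ℝ → ℝ} {s t : ℝ} (ht : 0 < t) (ha : ContinuousAt a s) (hb : ContinuousAt b s) :
    ContinuousAt (fun s => R3 s (a s) (b s) t) s := by
  have hT : ContinuousAt (fun s => TT s t) s := by
    unfold TT
    have : ContinuousAt (fun s : ℝ => t ^ (-s)) s :=
      (Real.continuousAt_const_rpow ht.ne').comp continuousAt_neg
    fun_prop
  have hcA : ContinuousAt (fun s => cA (a s)) s := by unfold cA; fun_prop
  have p0 : ContinuousAt (fun s => ps0 s (a s) t) s := by unfold ps0; fun_prop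
  have hE : ContinuousAt (fun s => EE s (a s) t) s := by unfold EE; fun_prop
  have h0 : ContinuousAt (fun s => ch0 s (a s) (b s) t) s := by unfold ch0; fun_prop
  have h1 : ContinuousAt (fun s => ch1 s (a s) (b s) t) s := by unfold ch1; fun_prop
  have h2 : ContinuousAt (fun s => ch2 s (a s) (b s) t) s := by unfold ch2; fun_prop
  have h3 : ContinuousAt (fun s => tch3 s (a s) (b s) t) s := by unfold tch3; fun_prop
  have p1 : ContinuousAt (fun s => ps1 s (a s) t) s := by unfold ps1; fun_prop
  have p2 : ContinuousAt (fun s => ps2 s (a s) t) s := by unfold ps2; fun_prop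
  have p3 : ContinuousAt (fun s => tps3 s (a s) t) s := by unfold tps3; fun_prop
  unfold R3
  fun_prop

lemma Bd.integ {f : ℝ → ℝ → ℝ → ℝ → ℂ} (h : Bd 16 (fun s a b t => f s a b t * Complex.exp t))
    {s a b : ℝ} (hm : Measurable (f s a b)) (hs : |s| ≤ 1/32) (ha : |a| ≤ 1) (hb : |b| ≤ 4) :
    IntegrableOn (f s a b) (Ioi 0) := by
  obtain ⟨K, hK, h⟩ := h.dom
  exact Integrable.mono' (dm_int.const_mul K) hm.aestronglyMeasurable
      ((ae_restrict_iff' measurableSet_Ioi).2 (Eventually.of_forall (fun t ht =>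
        h s a b t hs ha hb ht)))

lemma ft_R0 {s a b x : ℝ} (hx : x ≠ 0) (hs : |s| ≤ 1/32) (ha : |a| ≤ 1) (hb : |b| ≤ 4) :
    (ft x (R0 s a b)).re = ((ft x (R3 s a b)) / (Complex.I * x) ^ 3).re := by
  obtain ⟨m0, m1, m2, m3⟩ := meas_R s a b
  have i0 := Bd.R0.integ m0 hs ha hb
  have i1 := Bd.R1.integ m1 hs ha hb
  have i2 := Bd.R2.integ m2 hs ha hb
  have i3 := Bd.R3.integ m3 hs ha hb
  have l0 := Bd.R0z.lim hs ha hb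
  have l1 : Tendsto (R1 s a b) (𝓝[>] 0) (𝓝 (Complex.I * b)) := by
    have := (Bd.lim (f := fun s a b t => R1 s a b t - Complex.I * b) Bd.R1z hs ha hb).add_const
      (Complex.I * b)
    simpa using this
  have l2 : Tendsto (R2 s a b) (𝓝[>] 0) (𝓝 (-(2 * a * b))) := by
    have := (Bd.lim (f := fun s a b t => R2 s a b t + 2 * a * b) Bd.R2z hs ha hb).add_const
      (-(2 * (a:ℂ) * b))
    simpa using this
  rw [ft_ibp hx (fun t ht => hd_R0 ht) i0 i1 l0, ft_ibp hx (fun t ht => hd_R1 ht) i1 i2 l1,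
    ft_ibp hx (fun t ht => hd_R2 ht) i2 i3 l2]
  have hxc : (x:ℂ) ≠ 0 := by exact_mod_cast hx
  have hI := Complex.I_ne_zero
  have e : (0 + (Complex.I * b + (-(2 * a * b) + ft x (R3 s a b)) / (Complex.I * x)) / (Complex.I * x))
      / (Complex.I * x) = ft x (R3 s a b) / (Complex.I * x) ^ 3
        + Complex.I * ((-(b / x ^ 2) - 2 * a * b / x ^ 3 : ℝ) : ℂ) := by
    push_cast
    have h2 : Complex.I ^ 2 = -1 := Complex.I_sq
    have h3 : Complex.I ^ 3 = -Complex.I := by rw [pow_succ, h2]; ring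
    have h4 : Complex.I ^ 4 = 1 := Complex.I_pow_four
    field_simp
    ring_nf
    simp only [h2, h4]
    ring
  rw [e, Complex.add_re, Complex.re_mul_ofReal]
  simp only [Complex.I_re, zero_mul, add_zero]

end fourier

section gammaPart

/-- power times exponential -/
noncomputable def QQ (z t : ℝ) : ℂ := ((t ^ (z - 1) : ℝ) : ℂ) * ee t

lemma ee_ofReal (t : ℝ) : ee t = ((Real.exp (-t) : ℝ) : ℂ) := by unfold ee; push_cast; rfl

lemma QQ_int {z : ℝ} (hz : 0 < z) : IntegrableOn (QQ z) (Ioi 0) := by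
  have h := (Real.GammaIntegral_convergent hz).ofReal (𝕜 := ℂ)
  refine h.congr (Eventually.of_forall (fun t => ?_))
  unfold QQ
  rw [ee_ofReal]
  change ((Real.exp (-t) * t ^ (z - 1) : ℝ) : ℂ) = _
  rw [Complex.ofReal_mul, mul_comm]

lemma QQ_succ {z t : ℝ} (ht : 0 < t) : QQ (z + 1) t = t * QQ z t := by
  unfold QQ
  rw [show z + 1 - 1 = (z - 1) + 1 by ring, Real.rpow_add ht, Real.rpow_one]
  push_cast; ring

lemma QQ_rec {z : ℝ} (hz : 0 < z) (x : ℝ) :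
    (1 + Complex.I * x) * ft x (QQ (z + 1)) = z * ft x (QQ z) := by
  have i1 := QQ_int (show 0 < z + 1 by linarith)
  have i0 := QQ_int hz
  have hd : ∀ t ∈ Ioi (0:ℝ), HasDerivAt (QQ (z + 1)) ((z:ℂ) * QQ z t + -QQ (z + 1) t) t := by
    intro t ht
    have ht : 0 < t := ht
    have h := (Real.hasDerivAt_rpow_const (x := t) (p := z + 1 - 1)
      (Or.inl ht.ne')).ofReal_comp.mul (hd_ee (t := t))
    refine h.congr_deriv ?_
    unfold QQ
    simp only [add_sub_cancel_right]
    push_cast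
    ring
  have h0 : Tendsto (QQ (z + 1)) (𝓝[>] 0) (𝓝 0) := by
    have : ContinuousAt (QQ (z + 1)) 0 := by
      unfold QQ ee
      have := Real.continuousAt_rpow_const 0 (z + 1 - 1) (Or.inr (by linarith))
      fun_prop
    have h2 := this.tendsto.mono_left (nhdsWithin_le_nhds (s := Ioi 0))
    have e : QQ (z + 1) 0 = 0 := by
      unfold QQ
      rw [Real.zero_rpow (by simpa using hz.ne')]; simp
    rwa [e] at h2
  have i2 : IntegrableOn (fun t => (z:ℂ) * QQ z t) (Ioi 0) := i0.const_mul _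
  have i3 : IntegrableOn (fun t => -QQ (z + 1) t) (Ioi 0) := i1.neg
  have key := ft_ibp0 x hd i1 (i2.add i3) h0
  rw [ft_add x i2 i3] at key
  have e1 : ft x (fun t => (z:ℂ) * QQ z t) = z * ft x (QQ z) := by
    unfold ft; rw [← integral_const_mul]; congr 1; funext t; ring
  have e2 : ft x (fun t => -QQ (z + 1) t) = - ft x (QQ (z + 1)) := by
    unfold ft; rw [← integral_neg]; congr 1; funext t; ring
  rw [e1, e2] at key
  linear_combination key

lemma QQ_meas (z : ℝ) : Measurable (QQ z) := by
  have := meas_ee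
  unfold QQ; fun_prop

lemma QQ_deriv {z : ℝ} (hz : 0 < z) (x : ℝ) :
    HasDerivAt (fun x => ft x (QQ z)) (-Complex.I * ft x (QQ (z + 1))) x := by
  have i1 := QQ_int (show 0 < z + 1 by linarith)
  have i0 := QQ_int hz
  have h := (hasDerivAt_integral_of_dominated_loc_of_deriv_le (μ := volume.restrict (Ioi (0:ℝ)))
    (F := fun (x:ℝ) (t:ℝ) => Complex.exp (-(Complex.I * (t:ℂ) * (x:ℂ))) * QQ z t)
    (F' := fun (x:ℝ) (t:ℝ) => -Complex.I * (Complex.exp (-(Complex.I * (t:ℂ) * (x:ℂ))) * QQ (z + 1) t))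
    (x₀ := x) (s := univ) (bound := fun t => ‖QQ (z + 1) t‖) univ_mem ?_ (ker_int x i0) ?_ ?_
    i1.norm ?_).2
  · rw [integral_const_mul] at h
    exact h
  · exact Eventually.of_forall (fun y => ((meas_ker y).mul (QQ_meas z)).aestronglyMeasurable)
  · exact (((meas_ker x).mul (QQ_meas (z + 1))).const_mul _).aestronglyMeasurable
  · refine Eventually.of_forall (fun t y _ => ?_)
    rw [norm_mul, norm_mul, norm_ker]; simp
  · refine (ae_restrict_iff' measurableSet_Ioi).2 (Eventually.of_forall (fun t ht y _ => ?_))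
    have h := (((hd_t (t := y)).const_mul (Complex.I * (t:ℂ))).neg.cexp).mul_const (QQ z t)
    refine h.congr_deriv ?_
    rw [QQ_succ ht]
    simp only [Pi.neg_apply]
    ring

lemma w_slit (x : ℝ) : (1 + Complex.I * (x:ℂ)) ∈ Complex.slitPlane := by
  rw [Complex.mem_slitPlane_iff]; left; simp

lemma w_ne (x : ℝ) : (1 + Complex.I * (x:ℂ)) ≠ 0 := Complex.slitPlane_ne_zero (w_slit x)

lemma gam {z : ℝ} (hz : 0 < z) (x : ℝ) :
    ft x (QQ z) = Complex.exp (-(z * Complex.log (1 + Complex.I * x))) * Complex.Gamma z := by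
  set g : ℝ → ℂ := fun x => Complex.exp (z * Complex.log (1 + Complex.I * x)) * ft x (QQ z) with hg
  have hd : ∀ x, HasDerivAt g 0 x := by
    intro x
    have hw : HasDerivAt (fun x : ℝ => (1 + Complex.I * (x:ℂ))) (Complex.I * 1) x :=
      ((hd_t (t := x)).const_mul Complex.I).const_add 1
    have h1 := ((hw.clog_real (w_slit x)).const_mul (z:ℂ)).cexp.mul (QQ_deriv hz x)
    refine h1.congr_deriv ?_
    have hne := w_ne x
    have hr := QQ_rec hz x
    field_simp
    linear_combination (-Complex.exp (z * Complex.log (1 + Complex.I * x)) * Complex.I) * hr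
  have hc : g x = g 0 := is_const_of_deriv_eq_zero (fun x => (hd x).differentiableAt)
    (fun x => (hd x).deriv) x 0
  have g0 : g 0 = Complex.Gamma z := by
    simp only [hg]
    simp only [Complex.ofReal_zero, mul_zero, add_zero, Complex.log_one, Complex.exp_zero, one_mul]
    rw [Complex.Gamma_eq_integral (by simpa using hz), Complex.GammaIntegral_ofReal]
    unfold ft
    rw [← integral_complex_ofReal]
    congr 1; funext t
    unfold QQ
    rw [ee_ofReal]
    push_cast
    simp; ring
  rw [← g0, ← hc, hg, ← mul_assoc, ← Complex.exp_add]
  simp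

lemma gam_deriv {z : ℝ} (hz : 0 < z) (x : ℝ) :
    ft x (fun t => LL t * QQ z t) = Complex.exp (-(z * Complex.log (1 + Complex.I * x))) *
      (deriv Complex.Gamma z - Complex.Gamma z * Complex.log (1 + Complex.I * x)) := by
  set f : ℝ → ℂ := fun t => Complex.exp (-(Complex.I * (t:ℂ) * (x:ℂ))) * ee t with hf
  have hcf : Continuous f := by rw [hf]; unfold ee; fun_prop
  have hn : ∀ t, ‖f t‖ = Real.exp (-t) := by
    intro t
    rw [hf, norm_mul, norm_ker, one_mul]
    unfold ee; rw [Complex.norm_exp]; simp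
  have h := (mellin_hasDerivAt_of_isBigO_rpow (E := ℂ) (f := f) (s := (z:ℂ)) (a := z + 1) (b := 0)
    (hcf.continuousOn.locallyIntegrableOn measurableSet_Ioi) ?_ (by simp) ?_ (by simpa using hz)).2
  · have h1 := h.comp_ofReal
    have e1 : (fun y : ℝ => mellin f y) =ᶠ[𝓝 z] (fun y : ℝ => ft x (QQ y)) := by
      filter_upwards with y
      unfold mellin ft
      refine setIntegral_congr_fun measurableSet_Ioi (fun t ht => ?_)
      have ht : 0 < t := ht
      simp only [hf, smul_eq_mul, QQ]
      rw [Complex.ofReal_cpow ht.le]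
      push_cast; ring
    have e2 : mellin (fun t => Real.log t • f t) (z:ℂ) = ft x (fun t => LL t * QQ z t) := by
      unfold mellin ft
      refine setIntegral_congr_fun measurableSet_Ioi (fun t ht => ?_)
      have ht : 0 < t := ht
      simp only [hf, smul_eq_mul, QQ, LL, Complex.real_smul]
      rw [Complex.ofReal_cpow ht.le]
      push_cast; ring
    rw [e2] at h1
    have h2 := h1.congr_of_eventuallyEq e1.symm
    have e3 : (fun y : ℝ => Complex.exp (-(y * Complex.log (1 + Complex.I * x))) * Complex.Gamma y)
        =ᶠ[𝓝 z] (fun y : ℝ => ft x (QQ y)) := by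
      filter_upwards [lt_mem_nhds hz] with y hy
      rw [gam hy]
    have h3 := h2.congr_of_eventuallyEq e3
    have hG : HasDerivAt Complex.Gamma (deriv Complex.Gamma z) (z:ℂ) := by
      refine (Complex.differentiableAt_Gamma _ (fun m hm => ?_)).hasDerivAt
      have := congrArg Complex.re hm
      simp at this
      have : (0:ℝ) ≤ m := Nat.cast_nonneg m
      linarith
    have h4 := (((hd_t (t := z)).mul_const (Complex.log (1 + Complex.I * x))).neg.cexp).mul
      hG.comp_ofReal
    have h5 := h3.unique h4
    rw [h5]
    simp only [Pi.neg_apply]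
    ring
  · have := (isLittleO_exp_neg_mul_rpow_atTop (show (0:ℝ) < 1 by norm_num) (-(z + 1))).isBigO
    refine (Asymptotics.isBigO_iff.2 ?_)
    obtain ⟨c, hc⟩ := Asymptotics.isBigO_iff.1 this
    refine ⟨c, ?_⟩
    filter_upwards [hc] with t ht
    rw [hn]
    simpa using ht
  · simp only [neg_zero, Real.rpow_zero]
    have : Tendsto f (𝓝[>] 0) (𝓝 (f 0)) := (hcf.tendsto 0).mono_left nhdsWithin_le_nhds
    exact this.isBigO_one ℝ

end gammaPart

section mainTerm

/-- `a(s) = β tan (π s / 2)` -/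
noncomputable def aa (β s : ℝ) : ℝ := β * Real.tan (π * s / 2)
/-- derivative of `a` -/
noncomputable def bb (β s : ℝ) : ℝ := β * (π / 2) * (1 + Real.tan (π * s / 2) ^ 2)

lemma ft_cee {s a b : ℝ} (hs : |s| ≤ 1/32) (ha : |a| ≤ 1) (hb : |b| ≤ 4) (x : ℝ) :
    ft x (fun t => ch0 s a b t * ee t) =
      Complex.exp (-(((3 - s : ℝ) : ℂ) * Complex.log (1 + Complex.I * x))) *
      (cA a * (deriv Complex.Gamma ((3 - s : ℝ) : ℂ)
        - Complex.Gamma ((3 - s : ℝ) : ℂ) * Complex.log (1 + Complex.I * x))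
        - Complex.I * b * Complex.Gamma ((3 - s : ℝ) : ℂ)) := by
  have hz : 0 < 3 - s := by have := (abs_le.1 hs).2; linarith
  have e0 : ∀ t ∈ Ioi (0:ℝ), (t:ℂ) ^ 2 * TT s t * ee t = QQ (3 - s) t := by
    intro t ht
    have ht : 0 < t := ht
    unfold QQ TT
    rw [show (3 - s - 1) = 2 + -s by ring, Real.rpow_add ht]
    push_cast
    norm_num
  have i1 : IntegrableOn (fun t => LL t * QQ (3 - s) t) (Ioi 0) := by
    have hm : Measurable (fun t => ch0 s 0 0 t * ee t) := (meas_ch0 s 0 0).mul meas_ee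
    have := Bd.integ (f := fun s a b t => ch0 s a b t * ee t) Bd.cee hm hs (a := 0) (b := 0)
      (by norm_num) (by norm_num)
    refine this.congr_fun ?_ measurableSet_Ioi
    intro t ht
    simp only
    rw [← e0 t ht]
    unfold ch0 cA; push_cast; ring
  have i0 := QQ_int hz
  have j1 : IntegrableOn (fun t => cA a * (LL t * QQ (3 - s) t)) (Ioi 0) := i1.const_mul _
  have j0 : IntegrableOn (fun t => -(Complex.I * b) * QQ (3 - s) t) (Ioi 0) := i0.const_mul _
  have e1 : ft x (fun t => ch0 s a b t * ee t) = ft x (fun t => cA a * (LL t * QQ (3 - s) t)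
      + -(Complex.I * b) * QQ (3 - s) t) := by
    unfold ft
    refine setIntegral_congr_fun measurableSet_Ioi (fun t ht => ?_)
    simp only
    rw [← e0 t ht]
    unfold ch0; ring
  have e2 : ft x (fun t => cA a * (LL t * QQ (3 - s) t)) = cA a * ft x (fun t => LL t * QQ (3 - s) t) := by
    unfold ft; rw [← integral_const_mul]; congr 1; funext t; ring
  have e3 : ft x (fun t => -(Complex.I * b) * QQ (3 - s) t) = -(Complex.I * b) * ft x (QQ (3 - s)) := by
    unfold ft; rw [← integral_const_mul]; congr 1; funext t; ring
  rw [e1, ft_add x j1 j0, e2, e3, gam hz, gam_deriv hz]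
  ring

/-- error in the logarithm -/
noncomputable def eps (x : ℝ) : ℂ :=
  Complex.log (1 + Complex.I * x) - (Real.log x : ℝ) - Complex.I * (π / 2)

lemma eps_eq {x : ℝ} (hx : 0 < x) : eps x = Complex.log (((x⁻¹ : ℝ) : ℂ) + Complex.I) - Complex.log Complex.I := by
  unfold eps
  have hne : ((x⁻¹ : ℝ) : ℂ) + Complex.I ≠ 0 := by
    intro h; have := congrArg Complex.im h; simp at this
  have e : 1 + Complex.I * (x:ℂ) = (x:ℂ) * (((x⁻¹ : ℝ) : ℂ) + Complex.I) := by
    have : (x:ℂ) ≠ 0 := by exact_mod_cast hx.ne'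
    push_cast; field_simp
  rw [e, Complex.log_ofReal_mul hx hne, Complex.log_I]
  ring

lemma eps_bigO : eps =O[atTop] (fun x : ℝ => x⁻¹) := by
  have h : HasDerivAt (fun u : ℝ => Complex.log ((u : ℂ) + Complex.I)) (1 / (((0:ℝ):ℂ) + Complex.I)) 0 := by
    have h1 : HasDerivAt (fun u : ℝ => (u : ℂ) + Complex.I) 1 0 := (hd_t (t := 0)).add_const _
    refine h1.clog_real ?_
    rw [Complex.mem_slitPlane_iff]; right; simp
  have h2 := h.isBigO_sub
  have h3 := h2.comp_tendsto tendsto_inv_atTop_zero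
  refine Asymptotics.IsBigO.congr' h3 ?_ ?_
  · filter_upwards [eventually_gt_atTop 0] with x hx
    rw [eps_eq hx]
    simp [Function.comp]
  · filter_upwards with x
    simp [Function.comp]

lemma eps_lim : Tendsto eps atTop (𝓝 0) := eps_bigO.trans_tendsto tendsto_inv_atTop_zero

lemma log_inv_lim : Tendsto (fun x : ℝ => Real.log x * x⁻¹) atTop (𝓝 0) := by
  have := Real.isLittleO_log_id_atTop.tendsto_div_nhds_zero
  simpa [div_eq_mul_inv] using this

lemma log_eps_lim : Tendsto (fun x : ℝ => Real.log x * ‖eps x‖) atTop (𝓝 0) := by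
  have h : (fun x : ℝ => Real.log x * ‖eps x‖) =O[atTop] (fun x : ℝ => Real.log x * x⁻¹) :=
    (Asymptotics.isBigO_refl _ _).mul eps_bigO.norm_left
  exact h.trans_tendsto log_inv_lim

lemma J_form {s x : ℝ} (hx : 0 < x) :
    ((x ^ (3 - s) : ℝ) : ℂ) * Complex.exp (-(((3 - s : ℝ) : ℂ) * Complex.log (1 + Complex.I * x))) =
      Complex.I * Complex.exp (Complex.I * (π * s / 2)) * Complex.exp (-(((3 - s : ℝ) : ℂ) * eps x)) := by
  have hw : Complex.log (1 + Complex.I * x) = (Real.log x : ℝ) + Complex.I * (π / 2) + eps x := by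
    unfold eps; ring
  have e1 : ((x ^ (3 - s) : ℝ) : ℂ) = Complex.exp (((3 - s : ℝ) : ℂ) * (Real.log x : ℝ)) := by
    rw [Real.rpow_def_of_pos hx, Complex.ofReal_exp]
    push_cast; ring_nf
  have e2 : Complex.I = Complex.exp (Complex.I * (π / 2) - 2 * π * Complex.I) := by
    rw [Complex.exp_sub, Complex.exp_two_pi_mul_I, div_one]
    rw [show Complex.I * ((π:ℂ) / 2) = π / 2 * Complex.I by ring, Complex.exp_pi_div_two_mul_I]
  rw [hw, e1]
  nth_rewrite 2 [e2]
  rw [← Complex.exp_add, ← Complex.exp_add, ← Complex.exp_add]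
  congr 1
  push_cast
  ring

lemma Gamma_cont : ContinuousAt (fun s : ℝ => Complex.Gamma ((3 - s : ℝ) : ℂ)) 0 ∧
    ContinuousAt (fun s : ℝ => deriv Complex.Gamma ((3 - s : ℝ) : ℂ)) 0 := by
  have hA : AnalyticAt ℂ Complex.Gamma ((3 - 0 : ℝ) : ℂ) := by
    have ho : IsOpen {z : ℂ | 0 < z.re} := isOpen_lt continuous_const Complex.continuous_re
    have hd : DifferentiableOn ℂ Complex.Gamma {z : ℂ | 0 < z.re} := by
      intro z hz
      refine (Complex.differentiableAt_Gamma _ (fun m hm => ?_)).differentiableWithinAt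
      have h1 := congrArg Complex.re hm
      simp at h1
      have h2 : (0:ℝ) ≤ m := Nat.cast_nonneg m
      have h3 : 0 < z.re := hz
      linarith
    exact hd.analyticAt (ho.mem_nhds (by simp))
  have hc : ContinuousAt (fun s : ℝ => ((3 - s : ℝ) : ℂ)) 0 := by fun_prop
  exact ⟨hA.continuousAt.comp (f := fun s : ℝ => ((3 - s : ℝ) : ℂ)) hc,
    hA.deriv.continuousAt.comp (f := fun s : ℝ => ((3 - s : ℝ) : ℂ)) hc⟩

lemma aa_deriv {β s : ℝ} (hs : |s| < 1) : HasDerivAt (aa β) (bb β s) s := by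
  have hpi := Real.pi_pos
  obtain ⟨h1, h2⟩ := abs_lt.1 hs
  have hcos : Real.cos (π * s / 2) ≠ 0 := by
    refine (Real.cos_pos_of_mem_Ioo ⟨?_, ?_⟩).ne' <;> nlinarith
  have h := ((Real.hasDerivAt_tan hcos).comp s (((hasDerivAt_id s).const_mul π).div_const 2)).const_mul β
  refine h.congr_deriv ?_
  unfold bb
  rw [Real.tan_eq_sin_div_cos]
  have := Real.sin_sq_add_cos_sq (π * s / 2)
  simp only [mul_one]
  field_simp
  linear_combination (-β) * this

lemma aa_cont {β s : ℝ} (hs : |s| < 1) : ContinuousAt (aa β) s := (aa_deriv hs).continuousAt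
lemma bb_cont {β s : ℝ} (hs : |s| < 1) : ContinuousAt (bb β) s := by
  have := aa_cont (β := 1) hs
  have e : bb β = fun s => β * (π / 2) * (1 + aa 1 s ^ 2) := by
    funext s; unfold bb aa; ring
  rw [e]; fun_prop

lemma aa_zero (β : ℝ) : aa β 0 = 0 := by simp [aa]
lemma bb_zero (β : ℝ) : bb β 0 = β * (π / 2) := by simp [bb]

lemma tan_small {s : ℝ} (hs : |s| ≤ 1/32) : |Real.tan (π * s / 2)| ≤ 1 := by
  have hpi := Real.pi_pos
  obtain ⟨h1, h2⟩ := abs_le.1 hs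
  have mono := Real.strictMonoOn_tan.monotoneOn
  have u : Real.tan (π * s / 2) ≤ Real.tan (π / 4) :=
    mono ⟨by nlinarith, by nlinarith⟩ ⟨by nlinarith, by nlinarith⟩ (by nlinarith)
  have l : Real.tan (-(π / 4)) ≤ Real.tan (π * s / 2) :=
    mono ⟨by nlinarith, by nlinarith⟩ ⟨by nlinarith, by nlinarith⟩ (by nlinarith)
  rw [Real.tan_neg] at l
  rw [Real.tan_pi_div_four] at u l
  exact abs_le.2 ⟨l, u⟩

lemma aa_le {β s : ℝ} (hβ : |β| ≤ 1) (hs : |s| ≤ 1/32) : |aa β s| ≤ 1 := by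
  unfold aa; rw [abs_mul]
  exact mul_le_one₀ hβ (abs_nonneg _) (tan_small hs)

lemma bb_le {β s : ℝ} (hβ : |β| ≤ 1) (hs : |s| ≤ 1/32) : |bb β s| ≤ 4 := by
  have h := tan_small hs
  have hpi := Real.pi_lt_d2
  have hp := Real.pi_pos
  have h2 : Real.tan (π * s / 2) ^ 2 ≤ 1 := by rw [← sq_abs]; exact pow_le_one₀ (abs_nonneg _) h
  unfold bb
  rw [abs_mul, abs_mul, abs_of_pos (show (0:ℝ) < π / 2 by positivity),
    abs_of_pos (show (0:ℝ) < 1 + Real.tan (π * s / 2) ^ 2 by positivity)]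
  have h3 := abs_nonneg β
  calc |β| * (π / 2) * (1 + Real.tan (π * s / 2) ^ 2) ≤ 1 * (π / 2) * (1 + 1) := by gcongr
    _ ≤ 4 := by linarith

lemma re_main {β s : ℝ} (hs : |s| < 1) (g : ℝ) :
    (-(Complex.I * Complex.exp (Complex.I * (π * s / 2))) * cA (aa β s) * (g : ℂ)).re
      = g * (1 + β) * Real.sin (π * s / 2) := by
  have hpi := Real.pi_pos
  obtain ⟨h1, h2⟩ := abs_lt.1 hs
  have hcos : Real.cos (π * s / 2) ≠ 0 := by
    refine (Real.cos_pos_of_mem_Ioo ⟨?_, ?_⟩).ne' <;> nlinarith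
  have e : Complex.exp (Complex.I * (π * s / 2)) =
      (Real.cos (π * s / 2) : ℂ) + (Real.sin (π * s / 2) : ℂ) * Complex.I := by
    rw [show Complex.I * ((π:ℂ) * s / 2) = ((π * s / 2 : ℝ) : ℂ) * Complex.I by push_cast; ring,
      Complex.exp_mul_I, Complex.ofReal_cos, Complex.ofReal_sin]
  rw [e, Complex.re_mul_ofReal]
  have ht : aa β s * Real.cos (π * s / 2) = β * Real.sin (π * s / 2) := by
    unfold aa; rw [Real.tan_eq_sin_div_cos]; field_simp
  unfold cA
  simp only [Complex.mul_re, Complex.neg_re, Complex.I_re, Complex.add_re, Complex.ofReal_re,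
    Complex.ofReal_im, Complex.I_im, Complex.mul_im, Complex.neg_im, Complex.add_im, Complex.one_re,
    Complex.one_im]
  linear_combination g * ht

lemma main_lim (β : ℝ) (hβ : |β| ≤ 1) :
    Tendsto (fun q : ℝ × ℝ => q.2 ^ (3 - q.1) *
      (ft q.2 (fun t => ch0 q.1 (aa β q.1) (bb β q.1) t * ee t)).re / (1 + q.1 * Real.log q.2))
      (𝓝[>] 0 ×ˢ atTop) (𝓝 (π * (1 + β))) := by
  set l : Filter (ℝ × ℝ) := 𝓝[>] 0 ×ˢ atTop with hl
  have f1 : Tendsto (fun q : ℝ × ℝ => q.1) l (𝓝 0) := tendsto_fst.mono_right nhdsWithin_le_nhds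
  have f1' : Tendsto (fun q : ℝ × ℝ => q.1) l (𝓝[>] 0) := tendsto_fst
  have f2 : Tendsto (fun q : ℝ × ℝ => q.2) l atTop := tendsto_snd
  have hev : ∀ᶠ q in l, 0 < q.1 ∧ q.1 < 1/32 ∧ 1 < q.2 := by
    filter_upwards [f1'.eventually self_mem_nhdsWithin, f1.eventually (gt_mem_nhds (show (0:ℝ) < 1/32 by norm_num)),
      f2.eventually (eventually_gt_atTop 1)] with q h1 h2 h3
    exact ⟨h1, h2, h3⟩
  set z : ℝ × ℝ → ℂ := fun q => ((3 - q.1 : ℝ) : ℂ) with hz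
  set G : ℝ × ℝ → ℂ := fun q => Complex.Gamma (z q) with hG
  set G' : ℝ × ℝ → ℂ := fun q => deriv Complex.Gamma (z q) with hG'
  set V : ℝ × ℝ → ℂ := fun q => Complex.I * Complex.exp (Complex.I * (π * q.1 / 2)) with hV
  set e1 : ℝ × ℝ → ℂ := fun q => Complex.exp (-(z q * eps q.2)) with he1
  set A : ℝ × ℝ → ℂ := fun q => V q * e1 q * (cA (aa β q.1) * (G' q - G q * (Complex.I * (π / 2) + eps q.2))
    - Complex.I * (bb β q.1) * G q) with hA
  set Er : ℝ × ℝ → ℂ := fun q => -V q * cA (aa β q.1) * G q * ((Real.log q.2 : ℝ) * (e1 q - 1)) with hEr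
  have tz : Tendsto z l (𝓝 3) := by
    have : ContinuousAt (fun s : ℝ => ((3 - s : ℝ) : ℂ)) 0 := by fun_prop
    have h := this.tendsto.comp f1
    have e : ((3 - 0 : ℝ) : ℂ) = 3 := by norm_num
    rw [e] at h
    exact h
  have tG : Tendsto G l (𝓝 2) := by
    have h := Gamma_cont.1.tendsto.comp f1
    have e : Complex.Gamma ((3 - 0 : ℝ) : ℂ) = 2 := by
      have := Complex.Gamma_nat_eq_factorial 2
      norm_num at this ⊢
    rw [e] at h
    exact h
  obtain ⟨D, hD⟩ : ∃ D : ℝ, deriv Complex.Gamma ((3 - 0 : ℝ) : ℂ) = D := by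
    refine ⟨(2:ℕ).factorial * (-Real.eulerMascheroniConstant + harmonic 2), ?_⟩
    have := Complex.deriv_Gamma_nat 2
    push_cast at this ⊢
    rw [← this]
    norm_num
  have tG' : Tendsto G' l (𝓝 D) := by
    have h := Gamma_cont.2.tendsto.comp f1
    rw [hD] at h
    exact h
  have tV : Tendsto V l (𝓝 Complex.I) := by
    have : ContinuousAt (fun s : ℝ => Complex.I * Complex.exp (Complex.I * (π * s / 2))) 0 := by fun_prop
    have h := this.tendsto.comp f1
    have e : Complex.I * Complex.exp (Complex.I * (π * (0:ℝ) / 2)) = Complex.I := by simp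
    rw [e] at h
    exact h
  have teps : Tendsto (fun q : ℝ × ℝ => eps q.2) l (𝓝 0) := eps_lim.comp f2
  have tze : Tendsto (fun q : ℝ × ℝ => -(z q * eps q.2)) l (𝓝 0) := by
    simpa using (tz.mul teps).neg
  have te1 : Tendsto e1 l (𝓝 1) := by
    have := (Complex.continuous_exp.tendsto 0).comp tze
    rw [Complex.exp_zero] at this
    exact this
  have tcA : Tendsto (fun q : ℝ × ℝ => cA (aa β q.1)) l (𝓝 1) := by
    have h0 := aa_cont (β := β) (s := 0) (by norm_num)
    have : ContinuousAt (fun s : ℝ => cA (aa β s)) 0 := by unfold cA; fun_prop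
    have h := this.tendsto.comp f1
    have e : cA (aa β 0) = 1 := by simp [cA, aa_zero]
    rw [e] at h
    exact h
  have tbb : Tendsto (fun q : ℝ × ℝ => ((bb β q.1 : ℝ) : ℂ)) l (𝓝 ((β * (π / 2) : ℝ) : ℂ)) := by
    have h0 := bb_cont (β := β) (s := 0) (by norm_num)
    have : ContinuousAt (fun s : ℝ => ((bb β s : ℝ) : ℂ)) 0 := by fun_prop
    have h := this.tendsto.comp f1
    rw [bb_zero] at h
    exact h
  have tA : Tendsto A l (𝓝 (Complex.I * 1 * (1 * ((D:ℂ) - 2 * (Complex.I * (π / 2) + 0))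
      - Complex.I * ((β * (π / 2) : ℝ) : ℂ) * 2))) :=
    (tV.mul te1).mul ((tcA.mul (tG'.sub (tG.mul (teps.const_add _)))).sub ((tbb.const_mul _).mul tG))
  have tle : Tendsto (fun q : ℝ × ℝ => ((Real.log q.2 : ℝ) : ℂ) * (e1 q - 1)) l (𝓝 0) := by
    have hb : Tendsto (fun q : ℝ × ℝ => 2 * (‖z q‖ * (Real.log q.2 * ‖eps q.2‖))) l (𝓝 0) := by
      have := (tz.norm.mul (log_eps_lim.comp f2)).const_mul 2
      simpa using this
    refine squeeze_zero_norm' ?_ hb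
    have hsm : ∀ᶠ q in l, ‖-(z q * eps q.2)‖ ≤ 1 := by
      have := tze.norm
      rw [norm_zero] at this
      filter_upwards [this.eventually (gt_mem_nhds (show (0:ℝ) < 1 by norm_num))] with q hq using hq.le
    filter_upwards [hsm, hev] with q hq hq2
    have h1 := Complex.norm_exp_sub_one_le hq
    have hL : 0 ≤ Real.log q.2 := Real.log_nonneg hq2.2.2.le
    rw [norm_neg, norm_mul] at h1
    rw [norm_mul, Complex.norm_real, Real.norm_of_nonneg hL]
    calc _ ≤ Real.log q.2 * (2 * (‖z q‖ * ‖eps q.2‖)) := by gcongr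
      _ = _ := by ring
  have tEr : Tendsto Er l (𝓝 0) := by
    have := ((tV.neg.mul tcA).mul tG).mul tle
    rw [mul_zero] at this
    exact this
  have tp : Tendsto (fun q => (A q + Er q).re) l (𝓝 (π * (1 + β))) := by
    have := (Complex.continuous_re.tendsto _).comp (tA.add tEr)
    have e : (Complex.I * 1 * (1 * ((D:ℂ) - 2 * (Complex.I * (π / 2) + 0))
      - Complex.I * ((β * (π / 2) : ℝ) : ℂ) * 2) + 0).re = π * (1 + β) := by
      simp
      ring
    rw [e] at this
    exact this
  have tc : Tendsto (fun q : ℝ × ℝ => Real.Gamma (3 - q.1) * (1 + β) * (Real.sin (π * q.1 / 2) / q.1)) l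
      (𝓝 (π * (1 + β))) := by
    have hs : Tendsto (fun s : ℝ => Real.sin (π * s / 2) / s) (𝓝[>] 0) (𝓝 (π / 2)) := by
      have h : HasDerivAt (fun s : ℝ => Real.sin (π * s / 2)) (π / 2) 0 := by
        have := (((hasDerivAt_id (0:ℝ)).const_mul π).div_const 2).sin
        simpa using this
      have h2 := (hasDerivAt_iff_tendsto_slope.1 h).mono_left
        (nhdsWithin_mono 0 (show Ioi (0:ℝ) ⊆ {0}ᶜ by intro y hy; simpa using (ne_of_gt hy)))
      refine h2.congr (fun s => ?_)
      simp [slope_def_field]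
    have hg : Tendsto (fun q : ℝ × ℝ => Real.Gamma (3 - q.1)) l (𝓝 2) := by
      have := (Complex.continuous_re.tendsto _).comp tG
      have e : (2:ℂ).re = 2 := by simp
      rw [e] at this
      refine this.congr (fun q => ?_)
      simp only [Function.comp, hG, hz]
      rw [Complex.Gamma_ofReal, Complex.ofReal_re]
    have := (hg.mul_const (1 + β)).mul (hs.comp f1')
    have e : 2 * (1 + β) * (π / 2) = π * (1 + β) := by ring
    rw [e] at this
    exact this
  set p := fun q => (A q + Er q).re with hp
  set c := fun q : ℝ × ℝ => Real.Gamma (3 - q.1) * (1 + β) * (Real.sin (π * q.1 / 2) / q.1) with hc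
  set m := π * (1 + β) with hm
  have key : Tendsto (fun q : ℝ × ℝ => (p q + c q * (q.1 * Real.log q.2)) / (1 + q.1 * Real.log q.2)) l (𝓝 m) := by
    rw [tendsto_iff_norm_sub_tendsto_zero] at tp tc ⊢
    have := tp.add tc
    rw [add_zero] at this
    refine squeeze_zero' (Eventually.of_forall (fun q => norm_nonneg _)) ?_ this
    filter_upwards [hev] with q ⟨h1, h2, h3⟩
    have hy : 0 ≤ q.1 * Real.log q.2 := mul_nonneg h1.le (Real.log_nonneg h3.le)
    set y := q.1 * Real.log q.2
    have e : (p q + c q * y) / (1 + y) - m = (p q - m) * (1 / (1 + y)) + (c q - m) * (y / (1 + y)) := by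
      field_simp; ring
    rw [e]
    have b1 : ‖1 / (1 + y)‖ ≤ 1 := by
      rw [Real.norm_of_nonneg (by positivity)]
      rw [div_le_one (by positivity)]; linarith
    have b2 : ‖y / (1 + y)‖ ≤ 1 := by
      rw [Real.norm_of_nonneg (by positivity)]
      rw [div_le_one (by positivity)]; linarith
    refine (norm_add_le _ _).trans ?_
    rw [norm_mul, norm_mul]
    exact add_le_add (mul_le_of_le_one_right (norm_nonneg _) b1) (mul_le_of_le_one_right (norm_nonneg _) b2)
  refine key.congr' ?_
  filter_upwards [hev] with q ⟨h1, h2, h3⟩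
  congr 1
  have hs : |q.1| ≤ 1/32 := by rw [abs_of_pos h1]; exact h2.le
  have hx : 0 < q.2 := by linarith
  have e := ft_cee hs (aa_le hβ hs) (bb_le hβ hs) q.2
  rw [← Complex.re_ofReal_mul, e, ← mul_assoc ((q.2 ^ (3 - q.1) : ℝ) : ℂ), J_form hx]
  have hw : Complex.log (1 + Complex.I * q.2) = (Real.log q.2 : ℝ) + Complex.I * (π / 2) + eps q.2 := by
    unfold eps; ring
  have hM := re_main (β := β) (s := q.1) (by linarith) (Real.Gamma (3 - q.1))
  have e3 : c q * (q.1 * Real.log q.2) = Real.log q.2 *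
      (-V q * cA (aa β q.1) * G q).re := by
    have hGr : G q = (Real.Gamma (3 - q.1) : ℝ) := by
      simp only [hG, hz]; rw [Complex.Gamma_ofReal]
    rw [hGr]
    simp only [hV]
    rw [hM]
    simp only [hc]
    field_simp
  rw [e3, ← Complex.re_ofReal_mul, hp, ← Complex.add_re]
  congr 1
  rw [hw]
  simp only [hA, hEr]
  simp only [hV, he1, hG, hG', hz]
  ring

end mainTerm

section keyLimit

/-- the `s`-derivative of the characteristic function -/
noncomputable def GG (s a b t : ℝ) : ℂ := (ch0 s a b t + Complex.I * b * t) * EE s a t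

lemma meas_GG (s a b : ℝ) : Measurable (GG s a b) := by
  have := meas_EE s a
  have := meas_ch0 s a b
  unfold GG; fun_prop

/-- the `s`-derivative of the density -/
noncomputable def KK (β s x : ℝ) : ℝ := (1 / π) * (ft x (GG s (aa β s) (bb β s))).re

lemma ft_GG {s a b : ℝ} (hs : |s| ≤ 1/32) (ha : |a| ≤ 1) (hb : |b| ≤ 4) (x : ℝ) :
    ft x (GG s a b) = ft x (R0 s a b) + ft x (fun t => ch0 s a b t * ee t) := by
  have i0 := Bd.R0.integ (meas_R s a b).1 hs ha hb
  have i1 := Bd.integ (f := fun s a b t => ch0 s a b t * ee t) Bd.cee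
    ((meas_ch0 s a b).mul meas_ee) hs ha hb
  rw [← ft_add x i0 i1]
  congr 1
  funext t
  unfold GG R0
  ring

lemma R_lim (β : ℝ) (hβ : |β| ≤ 1) :
    Tendsto (fun q : ℝ × ℝ => q.2 ^ (3 - q.1) *
      (ft q.2 (R0 q.1 (aa β q.1) (bb β q.1))).re / (1 + q.1 * Real.log q.2))
      (𝓝[>] 0 ×ˢ atTop) (𝓝 0) := by
  obtain ⟨K, hK, hKb⟩ := Bd.R3.dom
  have hsm : ∀ᶠ s in 𝓝 (0:ℝ), |s| ≤ 1/32 := by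
    have : Metric.closedBall (0:ℝ) (1/32) ∈ 𝓝 (0:ℝ) := Metric.closedBall_mem_nhds _ (by norm_num)
    filter_upwards [this] with s hs
    simpa [Metric.mem_closedBall, dist_zero_right] using hs
  have hj := ft_joint (fun s => R3 s (aa β s) (bb β s)) (fun t => K * dm t) (dm_int.const_mul K)
    (fun s => (meas_R _ _ _).2.2.2)
    (by
      filter_upwards [hsm] with s hs t ht
      exact hKb s _ _ t hs (aa_le hβ hs) (bb_le hβ hs) ht)
    (fun t ht => cont_R3 ht (aa_cont (by norm_num)) (bb_cont (by norm_num)))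
  have hj2 : Tendsto (fun q : ℝ × ℝ => ‖ft q.2 (R3 q.1 (aa β q.1) (bb β q.1))‖)
      (𝓝[>] 0 ×ˢ atTop) (𝓝 0) := by
    have := (hj.mono_left (Filter.prod_mono (nhdsWithin_le_nhds (s := Ioi 0)) le_rfl)).norm
    rw [norm_zero] at this
    exact this
  refine squeeze_zero_norm' ?_ hj2
  have f1' : Tendsto (fun q : ℝ × ℝ => q.1) (𝓝[>] (0:ℝ) ×ˢ (atTop : Filter ℝ)) (𝓝[>] 0) := tendsto_fst
  have f2 : Tendsto (fun q : ℝ × ℝ => q.2) (𝓝[>] (0:ℝ) ×ˢ (atTop : Filter ℝ)) atTop := tendsto_snd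
  filter_upwards [f1'.eventually self_mem_nhdsWithin,
    (f1'.mono_right nhdsWithin_le_nhds).eventually hsm,
    f2.eventually (eventually_gt_atTop 1)] with q h1 h2 h3
  have h1 : 0 < q.1 := h1
  have hx : 0 < q.2 := by linarith
  rw [ft_R0 hx.ne' h2 (aa_le hβ h2) (bb_le hβ h2)]
  set Q := ft q.2 (R3 q.1 (aa β q.1) (bb β q.1))
  have hy : 0 ≤ q.1 * Real.log q.2 := mul_nonneg h1.le (Real.log_nonneg h3.le)
  have hp : (0:ℝ) < q.2 ^ (3 - q.1) := Real.rpow_pos_of_pos hx _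
  rw [norm_div, norm_mul, Real.norm_of_nonneg hp.le, Real.norm_of_nonneg (show 0 ≤ 1 + q.1 * Real.log q.2 by linarith)]
  rw [div_le_iff₀ (by linarith)]
  have b1 : ‖(Q / (Complex.I * q.2) ^ 3).re‖ ≤ ‖Q‖ / q.2 ^ (3:ℕ) := by
    refine (Complex.abs_re_le_norm _).trans (le_of_eq ?_)
    rw [norm_div, norm_pow, norm_mul, Complex.norm_I, one_mul, Complex.norm_real,
      Real.norm_of_nonneg hx.le]
  have b2 : q.2 ^ (3 - q.1) ≤ q.2 ^ (3:ℕ) := by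
    rw [← Real.rpow_natCast]
    exact Real.rpow_le_rpow_of_exponent_le h3.le (by push_cast; linarith)
  calc q.2 ^ (3 - q.1) * ‖(Q / (Complex.I * q.2) ^ 3).re‖
      ≤ q.2 ^ (3:ℕ) * (‖Q‖ / q.2 ^ (3:ℕ)) := by gcongr
    _ = ‖Q‖ * 1 := by field_simp
    _ ≤ _ := by gcongr; linarith

lemma key_lim (β : ℝ) (hβ : |β| ≤ 1) :
    Tendsto (fun q : ℝ × ℝ => q.2 ^ (3 - q.1) * KK β q.1 q.2 / (1 + q.1 * Real.log q.2))
      (𝓝[>] 0 ×ˢ atTop) (𝓝 (1 + β)) := by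
  have h := ((R_lim β hβ).add (main_lim β hβ)).const_mul (1 / π)
  have e : (1 / π) * (0 + π * (1 + β)) = 1 + β := by
    have := Real.pi_ne_zero
    field_simp; ring
  rw [e] at h
  refine h.congr' ?_
  have f1' : Tendsto (fun q : ℝ × ℝ => q.1) (𝓝[>] (0:ℝ) ×ˢ (atTop : Filter ℝ)) (𝓝[>] 0) := tendsto_fst
  filter_upwards [f1'.eventually self_mem_nhdsWithin,
    (f1'.mono_right nhdsWithin_le_nhds).eventually (gt_mem_nhds (show (0:ℝ) < 1/32 by norm_num))] with q h1 h2
  have h1 : 0 < q.1 := h1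
  have hs : |q.1| ≤ 1/32 := by rw [abs_of_pos h1]; exact h2.le
  unfold KK
  rw [ft_GG hs (aa_le hβ hs) (bb_le hβ hs), Complex.add_re]
  ring

end keyLimit

/-- The rescaling radius `r = 2 √(log (1/Δ))`. -/
noncomputable def rr (Δ : ℝ) : ℝ := 2 * Real.sqrt (Real.log (1 / Δ))

lemma tendsto_log_inv : Tendsto (fun Δ : ℝ => Real.log (1 / Δ)) (𝓝[>] 0) atTop := by
  have h : Tendsto (fun Δ : ℝ => 1 / Δ) (𝓝[>] 0) atTop := by
    simpa [one_div] using tendsto_inv_nhdsGT_zero (𝕜 := ℝ)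
  exact Real.tendsto_log_atTop.comp h

lemma tendsto_rr : Tendsto rr (𝓝[>] 0) atTop := by
  unfold rr
  exact (Real.tendsto_sqrt_atTop.comp tendsto_log_inv).const_mul_atTop (by norm_num)

lemma rr_sq {Δ : ℝ} (h0 : 0 < Δ) (h1 : Δ < 1) : rr Δ ^ 2 = 4 * Real.log (1 / Δ) := by
  unfold rr
  have : 0 ≤ Real.log (1 / Δ) := Real.log_nonneg (by rw [le_div_iff₀ h0]; linarith)
  rw [mul_pow, Real.sq_sqrt this]; norm_num

lemma eq_exp_rr {Δ : ℝ} (h0 : 0 < Δ) (h1 : Δ < 1) : Real.exp (-(rr Δ ^ 2) / 4) = Δ := by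
  rw [rr_sq h0 h1]
  have : -(4 * Real.log (1 / Δ)) / 4 = Real.log Δ := by
    rw [one_div, Real.log_inv]; ring
  rw [this, Real.exp_log h0]

lemma ev_small (d : ℝ) (hd : 0 < d) : ∀ᶠ Δ : ℝ in 𝓝[>] 0, 0 < Δ ∧ Δ < d := by
  have := Ioo_mem_nhdsGT hd
  filter_upwards [this] with x hx using hx

lemma tendsto_pow_exp_sq (k : ℕ) (a : ℝ) (ha : 0 < a) :
    Tendsto (fun r : ℝ => r ^ k * Real.exp (-a * r ^ 2)) atTop (𝓝 0) := by
  have h := (Real.tendsto_pow_mul_exp_neg_atTop_nhds_zero k).comp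
    (tendsto_id.const_mul_atTop ha)
  have h2 : Tendsto (fun r : ℝ => (1 / a ^ k) * ((a * r) ^ k * Real.exp (-(a * r)))) atTop (𝓝 0) := by
    simpa using h.const_mul (1 / a ^ k)
  refine squeeze_zero' ?_ ?_ h2
  · filter_upwards [eventually_ge_atTop 0] with r hr
    positivity
  · filter_upwards [eventually_ge_atTop 1] with r hr
    have : (1 / a ^ k) * ((a * r) ^ k * Real.exp (-(a * r))) = r ^ k * Real.exp (-(a * r)) := by
      rw [mul_pow]; field_simp
    rw [this]
    gcongr
    have := mul_nonneg ha.le (mul_nonneg (by linarith : (0:ℝ) ≤ r) (by linarith : (0:ℝ) ≤ r - 1))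
    nlinarith

lemma tendsto_mul_rr_pow (k : ℕ) : Tendsto (fun Δ : ℝ => Δ * rr Δ ^ k) (𝓝[>] 0) (𝓝 0) := by
  have h := (tendsto_pow_exp_sq k (1/4) (by norm_num)).comp tendsto_rr
  refine h.congr' ?_
  filter_upwards [ev_small 1 one_pos] with Δ hΔ
  have := eq_exp_rr hΔ.1 hΔ.2
  simp only [Function.comp]
  rw [show -(1/4) * rr Δ ^ 2 = -(rr Δ ^ 2) / 4 by ring, this, mul_comm]

lemma normalDensity_pos (x : ℝ) : 0 < normalDensity x := by
  unfold normalDensity; positivity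

lemma normalDensity_anti {x y : ℝ} (hx : 0 ≤ x) (hxy : x ≤ y) :
    normalDensity y ≤ normalDensity x := by
  unfold normalDensity
  gcongr

/-- key limit along paths -/
lemma key_path {K : ℝ → ℝ → ℝ} {B : ℝ}
    (hkey : Tendsto (fun q : ℝ × ℝ => q.2 ^ (3 - q.1) * K q.1 q.2 / (1 + q.1 * Real.log q.2))
      (𝓝[>] 0 ×ˢ atTop) (𝓝 B)) (s : ℝ → ℝ) (hs : ∀ᶠ Δ in 𝓝[>] (0 : ℝ), 0 < s Δ ∧ s Δ ≤ Δ)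
    (u : ℝ) (hu : 0 < u) :
    Tendsto (fun Δ => (rr Δ * u) ^ 3 * K (s Δ) (rr Δ * u)) (𝓝[>] 0) (𝓝 B) := by
  have hx : Tendsto (fun Δ => rr Δ * u) (𝓝[>] 0) atTop := tendsto_rr.atTop_mul_const hu
  have hid : Tendsto (fun Δ : ℝ => Δ) (𝓝[>] 0) (𝓝 0) := tendsto_nhdsWithin_of_tendsto_nhds tendsto_id
  have hs0 : Tendsto s (𝓝[>] 0) (𝓝 0) := by
    refine squeeze_zero' ?_ ?_ hid
    · filter_upwards [hs] with Δ h using h.1.le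
    · filter_upwards [hs] with Δ h using h.2
  have hs1 : Tendsto s (𝓝[>] 0) (𝓝[>] 0) :=
    tendsto_nhdsWithin_iff.2 ⟨hs0, by filter_upwards [hs] with Δ h using h.1⟩
  have h1 := hkey.comp (hs1.prodMk hx)
  have hlog : Tendsto (fun Δ => s Δ * Real.log (rr Δ * u)) (𝓝[>] 0) (𝓝 0) := by
    have h3 : Tendsto (fun Δ => (Δ * rr Δ ^ 1) * u) (𝓝[>] 0) (𝓝 0) := by
      simpa using (tendsto_mul_rr_pow 1).mul_const u
    refine squeeze_zero' ?_ ?_ h3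
    · filter_upwards [hs, hx.eventually_ge_atTop 1] with Δ h hx1
      exact mul_nonneg h.1.le (Real.log_nonneg hx1)
    · filter_upwards [hs, hx.eventually_ge_atTop 1, ev_small 1 one_pos] with Δ h hx1 hd
      have : Real.log (rr Δ * u) ≤ rr Δ * u := (Real.log_le_sub_one_of_pos (by linarith)).trans (by linarith)
      have h5 : 0 ≤ Real.log (rr Δ * u) := Real.log_nonneg hx1
      calc s Δ * Real.log (rr Δ * u) ≤ Δ * (rr Δ * u) := by
            apply mul_le_mul h.2 this h5 hd.1.le
        _ = _ := by ring
  have hpow : Tendsto (fun Δ => Real.exp (s Δ * Real.log (rr Δ * u))) (𝓝[>] 0) (𝓝 1) := by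
    simpa [Function.comp_def] using (Real.continuous_exp.tendsto 0).comp hlog
  have h2 := (h1.mul (hlog.const_add 1)).mul hpow
  simp only [add_zero, mul_one] at h2
  refine h2.congr' ?_
  filter_upwards [hs, hx.eventually_ge_atTop 1] with Δ h hx1
  have hpos : 0 < rr Δ * u := by linarith
  have hne : 1 + s Δ * Real.log (rr Δ * u) ≠ 0 := by
    have := mul_nonneg h.1.le (Real.log_nonneg hx1); positivity
  simp only [Function.comp]
  rw [div_mul_cancel₀ _ hne, mul_comm (s Δ), ← Real.rpow_def_of_pos hpos, mul_right_comm,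
    ← Real.rpow_add hpos]
  congr 1
  rw [← Real.rpow_natCast]; norm_num

lemma D_eq {Δ u : ℝ} (h0 : 0 < Δ) (h1 : Δ < 1) :
    (rr Δ * u) ^ 3 * normalDensity (rr Δ * u) / Δ =
      (u ^ 3 * (1 / (2 * Real.sqrt Real.pi))) *
        (rr Δ ^ 3 * Real.exp (((1 - u ^ 2) / 4) * rr Δ ^ 2)) := by
  have h := eq_exp_rr h0 h1
  rw [div_eq_iff h0.ne']
  unfold normalDensity
  conv_rhs => rw [← h]
  rw [← h] 
  have : Real.exp (-(rr Δ * u) ^ 2 / 4) =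
    Real.exp (((1 - u ^ 2) / 4) * rr Δ ^ 2) * Real.exp (-(rr Δ ^ 2) / 4) := by
    rw [← Real.exp_add]; congr 1; ring
  rw [h, this, h]
  ring

lemma pointwise_lim (F K : ℝ → ℝ → ℝ) (B : ℝ) (hB : 0 < B)
    (hder : ∀ x s, |s| < 1/32 → HasDerivAt (fun s => F s x) (K s x) s)
    (h0 : ∀ x, F 0 x = normalDensity x)
    (hkey : Tendsto (fun q : ℝ × ℝ => q.2 ^ (3 - q.1) * K q.1 q.2 / (1 + q.1 * Real.log q.2))
      (𝓝[>] 0 ×ˢ atTop) (𝓝 B)) (u : ℝ) (hu : 0 < u) (hu1 : u ≠ 1) :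
    Tendsto (fun Δ => Δ * rr Δ ^ 3 * (K Δ (rr Δ * u) ^ 2 / F Δ (rr Δ * u))) (𝓝[>] 0)
      (𝓝 ((Ioi 1).indicator (fun u => B * u ^ (-3 : ℝ)) u)) := by
  have hmvt : ∀ Δ : ℝ, ∃ s : ℝ, 0 < Δ → Δ < 1/32 → ((0 < s ∧ s ≤ Δ) ∧
      K s (rr Δ * u) = (F Δ (rr Δ * u) - normalDensity (rr Δ * u)) / Δ) := by
    intro Δ
    by_cases h : 0 < Δ ∧ Δ < 1/32
    · obtain ⟨c, hc, hc2⟩ := exists_hasDerivAt_eq_slope (fun s => F s (rr Δ * u))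
        (fun s => K s (rr Δ * u)) h.1
        (fun s hs => (hder _ s (by rw [abs_lt]; constructor <;> linarith [hs.1, hs.2, h.2])).continuousAt.continuousWithinAt)
        (fun s hs => hder _ s (by rw [abs_lt]; constructor <;> linarith [hs.1, hs.2, h.2]))
      refine ⟨c, fun _ _ => ⟨⟨hc.1, hc.2.le⟩, ?_⟩⟩
      rw [hc2, h0]; simp
    · exact ⟨0, fun h1 h2 => absurd ⟨h1, h2⟩ h⟩
  choose s hs using hmvt
  have hsm : ∀ᶠ Δ in 𝓝[>] (0 : ℝ), 0 < s Δ ∧ s Δ ≤ Δ := by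
    filter_upwards [ev_small (1/32) (by norm_num)] with Δ hΔ using (hs Δ hΔ.1 hΔ.2).1
  have hself : ∀ᶠ Δ in 𝓝[>] (0 : ℝ), 0 < Δ ∧ Δ ≤ Δ := by
    filter_upwards [ev_small 1 one_pos] with Δ hΔ using ⟨hΔ.1, le_rfl⟩
  have hA := key_path hkey s hsm u hu
  have hA' := key_path hkey (fun Δ => Δ) hself u hu
  have heq : ∀ᶠ Δ in 𝓝[>] (0 : ℝ), u ^ (-3 : ℝ) * (((rr Δ * u) ^ 3 * K Δ (rr Δ * u)) ^ 2 /
      ((rr Δ * u) ^ 3 * K (s Δ) (rr Δ * u) +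
        (rr Δ * u) ^ 3 * normalDensity (rr Δ * u) / Δ)) =
      Δ * rr Δ ^ 3 * (K Δ (rr Δ * u) ^ 2 / F Δ (rr Δ * u)) := by
    filter_upwards [ev_small (1/32) (by norm_num), tendsto_rr.eventually_gt_atTop 0] with Δ hΔ hr
    rw [(hs Δ hΔ.1 hΔ.2).2]
    have e1 : (rr Δ * u) ^ 3 * ((F Δ (rr Δ * u) - normalDensity (rr Δ * u)) / Δ) +
        (rr Δ * u) ^ 3 * normalDensity (rr Δ * u) / Δ = (rr Δ * u) ^ 3 * F Δ (rr Δ * u) / Δ := by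
      ring
    rw [e1]
    have e2 : u ^ (-3 : ℝ) = 1 / u ^ 3 := by
      rw [Real.rpow_neg hu.le, one_div]; norm_cast
    rw [e2]
    have := hΔ.1.ne'
    by_cases hF : F Δ (rr Δ * u) = 0
    · simp [hF]
    · field_simp
  refine Tendsto.congr' heq ?_
  have hnum := hA'.pow 2
  have hDeq : ∀ᶠ Δ in 𝓝[>] (0 : ℝ), (u ^ 3 * (1 / (2 * Real.sqrt Real.pi))) *
        (rr Δ ^ 3 * Real.exp (((1 - u ^ 2) / 4) * rr Δ ^ 2)) =
        (rr Δ * u) ^ 3 * normalDensity (rr Δ * u) / Δ := by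
    filter_upwards [ev_small 1 one_pos] with Δ hΔ using (D_eq hΔ.1 hΔ.2).symm
  rcases lt_or_gt_of_ne hu1 with h | h
  · have hni : u ∉ Ioi (1:ℝ) := by simp [h.le]
    rw [indicator_of_notMem hni]
    have hD : Tendsto (fun Δ => (rr Δ * u) ^ 3 * normalDensity (rr Δ * u) / Δ) (𝓝[>] 0) atTop := by
      refine Tendsto.congr' hDeq ?_
      refine Tendsto.const_mul_atTop (by positivity) ?_
      have a1 : Tendsto (fun Δ => rr Δ ^ 3) (𝓝[>] 0) atTop :=
        (tendsto_pow_atTop (by norm_num)).comp tendsto_rr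
      have a2 : Tendsto (fun Δ => Real.exp (((1 - u ^ 2) / 4) * rr Δ ^ 2)) (𝓝[>] 0) atTop := by
        refine Real.tendsto_exp_atTop.comp ?_
        refine Tendsto.const_mul_atTop (by nlinarith) ?_
        exact (tendsto_pow_atTop (by norm_num)).comp tendsto_rr
      exact a1.atTop_mul_atTop₀ a2
    have := (hnum.div_atTop (hA.add_atTop hD)).const_mul (u ^ (-3 : ℝ))
    simpa using this
  · rw [indicator_of_mem (show u ∈ Ioi (1:ℝ) from h)]
    have hD : Tendsto (fun Δ => (rr Δ * u) ^ 3 * normalDensity (rr Δ * u) / Δ) (𝓝[>] 0) (𝓝 0) := by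
      refine Tendsto.congr' hDeq ?_
      have := ((tendsto_pow_exp_sq 3 ((u^2-1)/4) (by nlinarith)).comp tendsto_rr).const_mul
        (u ^ 3 * (1 / (2 * Real.sqrt Real.pi)))
      rw [mul_zero] at this
      refine this.congr ?_
      intro Δ
      simp only [Function.comp]
      congr 3; ring
    have := (hnum.div (hA.add hD) (by simpa using hB.ne')).const_mul (u ^ (-3 : ℝ))
    have e : B * u ^ (-3 : ℝ) = u ^ (-3 : ℝ) * (B ^ 2 / (B + 0)) := by
      rw [add_zero]; field_simp
    rw [e]
    exact this

lemma key_bounds {K : ℝ → ℝ → ℝ} {B : ℝ} (hB : 0 < B)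
    (hkey : Tendsto (fun q : ℝ × ℝ => q.2 ^ (3 - q.1) * K q.1 q.2 / (1 + q.1 * Real.log q.2))
      (𝓝[>] 0 ×ˢ atTop) (𝓝 B)) :
    ∃ X s0 : ℝ, 1 ≤ X ∧ 0 < s0 ∧ s0 ≤ 1/64 ∧ ∀ s x, 0 < s → s < s0 → X ≤ x →
      B / 2 * x ^ (-3 : ℝ) ≤ K s x ∧ K s x ≤ 2 * B * x ^ (-3 + 2 * s) := by
  have hev := (hkey.eventually (Ioo_mem_nhds (show B / 2 < B by linarith) (show B < 2 * B by linarith)))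
  rw [Filter.Eventually, mem_prod_iff] at hev
  obtain ⟨t1, ht1, t2, ht2, hsub⟩ := hev
  obtain ⟨d, hd, hd2⟩ := (mem_nhdsGT_iff_exists_Ioo_subset).1 ht1
  obtain ⟨X, hX⟩ := mem_atTop_sets.1 ht2
  refine ⟨max X 1, min d (1/64), le_max_right _ _, lt_min hd (by norm_num), min_le_right _ _, ?_⟩
  intro s x hs hs0 hx
  have hx1 : 1 ≤ x := (le_max_right _ _).trans hx
  have hxpos : 0 < x := by linarith
  have hm : (s, x) ∈ t1 ×ˢ t2 :=
    ⟨hd2 ⟨hs, hs0.trans_le (min_le_left _ _)⟩, hX x ((le_max_left _ _).trans hx)⟩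
  have h := hsub hm
  change B / 2 < x ^ (3 - s) * K s x / (1 + s * Real.log x) ∧
    x ^ (3 - s) * K s x / (1 + s * Real.log x) < 2 * B at h
  have hl : 0 ≤ s * Real.log x := mul_nonneg hs.le (Real.log_nonneg hx1)
  have hden : 0 < 1 + s * Real.log x := by linarith
  rw [lt_div_iff₀ hden, div_lt_iff₀ hden] at h
  have e1 : x ^ (3 - s) * x ^ (-3 + s) = 1 := by
    rw [← Real.rpow_add hxpos]; simp
  have hp : 0 < x ^ (-3 + s) := Real.rpow_pos_of_pos hxpos _
  have hK : K s x = x ^ (-3 + s) * (x ^ (3 - s) * K s x) := by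
    rw [← mul_assoc, mul_comm (x ^ (-3+s)), e1, one_mul]
  constructor
  · rw [hK]
    have a1 : x ^ (-3 : ℝ) ≤ x ^ (-3 + s) := Real.rpow_le_rpow_of_exponent_le hx1 (by linarith)
    have a2 : B / 2 ≤ x ^ (3 - s) * K s x := by nlinarith
    calc B / 2 * x ^ (-3 : ℝ) ≤ B / 2 * x ^ (-3 + s) := by gcongr
      _ = x ^ (-3 + s) * (B / 2) := by ring
      _ ≤ _ := by gcongr
  · rw [hK]
    have a1 : 1 + s * Real.log x ≤ x ^ s := by
      rw [Real.rpow_def_of_pos hxpos, mul_comm (Real.log x)]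
      linarith [Real.add_one_le_exp (s * Real.log x)]
    calc x ^ (-3 + s) * (x ^ (3 - s) * K s x) ≤ x ^ (-3 + s) * (2 * B * x ^ s) := by
          refine mul_le_mul_of_nonneg_left (h.2.le.trans ?_) hp.le
          gcongr
      _ = 2 * B * (x ^ (-3 + s) * x ^ s) := by ring
      _ = _ := by rw [← Real.rpow_add hxpos]; ring_nf

lemma F_lower (F K : ℝ → ℝ → ℝ) (hder : ∀ x s, |s| < 1/32 → HasDerivAt (fun s => F s x) (K s x) s)
    (h0 : ∀ x, F 0 x = normalDensity x) (Δ x : ℝ) (hΔ : 0 < Δ) (hΔ2 : Δ < 1/32) :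
    ∃ s, 0 < s ∧ s < Δ ∧ F Δ x = normalDensity x + Δ * K s x := by
  obtain ⟨c, hc, hc2⟩ := exists_hasDerivAt_eq_slope (fun s => F s x)
    (fun s => K s x) hΔ
    (fun s hs => (hder _ s (by rw [abs_lt]; constructor <;> linarith [hs.1, hs.2])).continuousAt.continuousWithinAt)
    (fun s hs => hder _ s (by rw [abs_lt]; constructor <;> linarith [hs.1, hs.2]))
  refine ⟨c, hc.1, hc.2, ?_⟩
  rw [hc2, h0, sub_zero, mul_div_cancel₀ _ hΔ.ne']; ring

lemma domin (F K : ℝ → ℝ → ℝ) (B C : ℝ) (hB : 0 < B)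
    (hder : ∀ x s, |s| < 1/32 → HasDerivAt (fun s => F s x) (K s x) s)
    (h0 : ∀ x, F 0 x = normalDensity x)
    (hC : ∀ s x, |s| < 1/32 → |K s x| ≤ C)
    (hkey : Tendsto (fun q : ℝ × ℝ => q.2 ^ (3 - q.1) * K q.1 q.2 / (1 + q.1 * Real.log q.2))
      (𝓝[>] 0 ×ˢ atTop) (𝓝 B)) :
    ∀ᶠ Δ in 𝓝[>] (0:ℝ), ∀ u ∈ Ioi (0:ℝ),
      ‖Δ * rr Δ ^ 3 * (K Δ (rr Δ * u) ^ 2 / F Δ (rr Δ * u))‖ ≤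
        (if u ≤ 1/2 then 1 else 32 * B * u ^ (-(5:ℝ)/2)) := by
  obtain ⟨X, s0, hX, hs0, hs1, hb⟩ := key_bounds hB hkey
  have hC0 : 0 ≤ C := (abs_nonneg _).trans (hC 0 0 (by norm_num))
  -- limits needed
  have hrpow : ∀ᶠ Δ in 𝓝[>] (0:ℝ), rr Δ ^ (4 * Δ) ≤ 2 := by
    have h3 : Tendsto (fun Δ => Real.exp (4 * (Δ * rr Δ ^ 1))) (𝓝[>] 0) (𝓝 1) := by
      have := (tendsto_mul_rr_pow 1).const_mul 4
      rw [mul_zero] at this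
      simpa [Function.comp_def] using (Real.continuous_exp.tendsto 0).comp this
    filter_upwards [h3.eventually (Iio_mem_nhds (show (1:ℝ) < 2 by norm_num)),
      tendsto_rr.eventually_ge_atTop 1, ev_small 1 one_pos] with Δ h1 h2 h4
    have hp : 0 < rr Δ := by linarith
    rw [Real.rpow_def_of_pos hp]
    refine le_trans (Real.exp_le_exp.2 ?_) (le_of_lt h1)
    have : Real.log (rr Δ) ≤ rr Δ := (Real.log_le_sub_one_of_pos hp).trans (by linarith)
    nlinarith [h4.1]
  have hlow : ∀ᶠ Δ in 𝓝[>] (0:ℝ), Δ * rr Δ ^ 3 * (C ^ 2 / (normalDensity (rr Δ / 2) / 2)) ≤ 1 := by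
    have h3 := ((tendsto_pow_exp_sq 3 (3/16) (by norm_num)).comp tendsto_rr).const_mul
      (C ^ 2 * 2 * (2 * Real.sqrt Real.pi))
    rw [mul_zero] at h3
    filter_upwards [h3.eventually (Iio_mem_nhds (show (0:ℝ) < 1 by norm_num)), ev_small 1 one_pos]
      with Δ h1 h2
    refine le_trans (le_of_eq ?_) (le_of_lt h1)
    simp only [Function.comp]
    unfold normalDensity
    have this : Δ = Real.exp (-(3/16) * rr Δ ^ 2) * Real.exp (-(rr Δ / 2) ^ 2 / 4) := by
      rw [← Real.exp_add]
      refine (eq_exp_rr h2.1 h2.2).symm.trans ?_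
      congr 1; ring
    have hpi : 0 < Real.sqrt Real.pi := Real.sqrt_pos.2 Real.pi_pos
    generalize Real.exp (-(3/16) * rr Δ ^ 2) = e1 at *
    have hp2 := Real.exp_pos (-(rr Δ / 2) ^ 2 / 4)
    generalize Real.exp (-(rr Δ / 2) ^ 2 / 4) = e2 at *
    generalize rr Δ = r at *
    subst this
    field_simp
  have hmid : ∀ᶠ Δ in 𝓝[>] (0:ℝ), Δ * C ≤ normalDensity X / 2 := by
    have : Tendsto (fun Δ : ℝ => Δ * C) (𝓝[>] 0) (𝓝 0) := by
      have := (tendsto_nhdsWithin_of_tendsto_nhds (s := Ioi (0:ℝ)) (tendsto_id (x := 𝓝 (0:ℝ)))).mul_const C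
      simpa using this
    have hp := normalDensity_pos X
    filter_upwards [this.eventually (Iio_mem_nhds (show (0:ℝ) < normalDensity X / 2 by linarith))] with Δ h
      using le_of_lt h
  filter_upwards [hrpow, hlow, hmid, ev_small s0 hs0, tendsto_rr.eventually_ge_atTop (2 * X)] with Δ h1 h2 h3 h4 h5
  intro u hu
  have hu0 : 0 < u := hu
  have hr1 : 1 ≤ rr Δ := by linarith
  have hr0 : 0 < rr Δ := by linarith
  have hΔ := h4.1
  have hΔ2 : Δ < 1/32 := by linarith [h4.2]
  have habs : |Δ| < 1/32 := by rw [abs_of_pos hΔ]; exact hΔ2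
  set x := rr Δ * u with hx
  have hx0 : 0 < x := by positivity
  obtain ⟨s, hs, hs', hF⟩ := F_lower F K hder h0 Δ x hΔ hΔ2
  have hn := normalDensity_pos x
  split_ifs with hcase
  · have hxr : x ≤ rr Δ / 2 := by rw [hx]; nlinarith
    have hFlow : normalDensity (rr Δ / 2) / 2 ≤ F Δ x := by
      have a1 := normalDensity_anti hx0.le hxr
      rcases le_total X x with hXx | hXx
      · have := (hb s x hs (hs'.trans h4.2) hXx).1
        have : 0 ≤ K s x := le_trans (by positivity) this
        have : 0 ≤ Δ * K s x := by positivity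
        rw [hF]; linarith
      · have a2 := normalDensity_anti hx0.le hXx
        have a3 : -C ≤ K s x := (abs_le.1 (hC s x (by rw [abs_of_pos hs]; linarith))).1
        have a4 : -(Δ * C) ≤ Δ * K s x := by nlinarith
        rw [hF]; linarith
    have hnr := normalDensity_pos (rr Δ / 2)
    have hFpos : 0 < F Δ x := by linarith
    rw [Real.norm_of_nonneg (by positivity)]
    refine le_trans ?_ h2
    have : K Δ x ^ 2 ≤ C ^ 2 := by
      rw [sq_le_sq, abs_of_nonneg hC0]; exact hC Δ x habs
    gcongr
  · push Not at hcase
    have hXx : X ≤ x := by rw [hx]; nlinarith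
    have hx1 : 1 ≤ x := hX.trans hXx
    have b1 := (hb s x hs (hs'.trans h4.2) hXx).1
    obtain ⟨b2, b3⟩ := hb Δ x hΔ h4.2 hXx
    have hp3 : 0 < x ^ (-3 : ℝ) := Real.rpow_pos_of_pos hx0 _
    have hK0 : 0 ≤ K Δ x := le_trans (by positivity) b2
    have hFlow : Δ * (B / 2 * x ^ (-3 : ℝ)) ≤ F Δ x := by
      have : Δ * (B / 2 * x ^ (-3 : ℝ)) ≤ Δ * K s x := by gcongr
      rw [hF]; linarith
    have hFp : 0 < F Δ x := lt_of_lt_of_le (by positivity) hFlow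
    rw [Real.norm_of_nonneg (by positivity)]
    have hxx : x ^ (-3 + 2 * Δ) * x ^ (-3 + 2 * Δ) = x ^ (-3 : ℝ) * x ^ (-3 + 4 * Δ) := by
      rw [← Real.rpow_add hx0, ← Real.rpow_add hx0]; ring_nf
    have hrx : rr Δ ^ 3 * x ^ (-3 + 4 * Δ) = rr Δ ^ (4 * Δ) * u ^ (-3 + 4 * Δ) := by
      rw [hx, Real.mul_rpow hr0.le hu0.le, ← mul_assoc]
      congr 1
      rw [← Real.rpow_natCast, ← Real.rpow_add hr0]
      norm_num
    have hup : u ^ (-3 + 4 * Δ) ≤ 2 * u ^ (-(5:ℝ)/2) := by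
      rcases le_total 1 u with h | h
      · have := Real.rpow_le_rpow_of_exponent_le h (show -3 + 4 * Δ ≤ -(5:ℝ)/2 by linarith)
        have : 0 < u ^ (-(5:ℝ)/2) := Real.rpow_pos_of_pos hu0 _
        linarith
      · have a1 : u ^ (-3 + 4 * Δ) ≤ u ^ (-1 + -(5:ℝ)/2) :=
          Real.rpow_le_rpow_of_exponent_ge hu0 h (by linarith)
        rw [Real.rpow_add hu0 (-1) (-(5:ℝ)/2), Real.rpow_neg_one] at a1
        have : u⁻¹ ≤ 2 := by
          rw [inv_le_comm₀ hu0 (by norm_num)]; linarith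
        refine a1.trans ?_
        gcongr
    calc Δ * rr Δ ^ 3 * (K Δ x ^ 2 / F Δ x)
        ≤ Δ * rr Δ ^ 3 * ((2 * B * x ^ (-3 + 2 * Δ)) ^ 2 / (Δ * (B / 2 * x ^ (-3 : ℝ)))) := by
          gcongr
      _ = 8 * B * (rr Δ ^ 3 * ((x ^ (-3 + 2 * Δ) * x ^ (-3 + 2 * Δ)) / x ^ (-3 : ℝ))) := by
          field_simp; ring
      _ = 8 * B * (rr Δ ^ (4 * Δ) * u ^ (-3 + 4 * Δ)) := by
          rw [hxx, mul_div_cancel_left₀ _ hp3.ne', hrx]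
      _ ≤ 8 * B * (2 * (2 * u ^ (-(5:ℝ)/2))) := by
          gcongr
      _ = _ := by ring

lemma bound_integrable (B : ℝ) : IntegrableOn
    (fun u : ℝ => if u ≤ 1/2 then (1:ℝ) else 32 * B * u ^ (-(5:ℝ)/2)) (Ioi 0) := by
  rw [← Ioc_union_Ioi_eq_Ioi (show (0:ℝ) ≤ 1/2 by norm_num)]
  refine IntegrableOn.union ?_ ?_
  · refine (integrableOn_const (C := (1:ℝ)) (by simp) (by simp)).congr_fun ?_ measurableSet_Ioc
    intro u hu
    simp only [if_pos hu.2]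
  · have h1 : IntegrableOn (fun u : ℝ => 32 * B * u ^ (-(5:ℝ)/2)) (Ioi (1/2)) :=
      (integrableOn_Ioi_rpow_of_lt (show -(5:ℝ)/2 < -1 by norm_num)
        (show (0:ℝ) < 1/2 by norm_num)).const_mul (32 * B)
    refine h1.congr_fun ?_ measurableSet_Ioi
    intro u hu
    simp only [if_neg (not_le.2 (mem_Ioi.1 hu))]

theorem partC (F K : ℝ → ℝ → ℝ) (B C : ℝ) (hB : 0 < B)
    (hder : ∀ x s, |s| < 1/32 → HasDerivAt (fun s => F s x) (K s x) s)
    (h0 : ∀ x, F 0 x = normalDensity x)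
    (hC : ∀ s x, |s| < 1/32 → |K s x| ≤ C)
    (hKm : ∀ s, |s| < 1/32 → Measurable (K s)) (hFm : ∀ s, |s| < 1/32 → Measurable (F s))
    (hkey : Tendsto (fun q : ℝ × ℝ => q.2 ^ (3 - q.1) * K q.1 q.2 / (1 + q.1 * Real.log q.2))
      (𝓝[>] 0 ×ˢ atTop) (𝓝 B)) :
    (∀ᶠ Δ in 𝓝[>] (0:ℝ), IntegrableOn (fun x => K Δ x ^ 2 / F Δ x) (Ioi 0)) ∧
    Tendsto (fun Δ => 4 * Δ * Real.log (1 / Δ) * ∫ x in Ioi (0:ℝ), K Δ x ^ 2 / F Δ x)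
      (𝓝[>] 0) (𝓝 (B / 2)) := by
  have hdom := domin F K B C hB hder h0 hC hkey
  have hmeas : ∀ᶠ Δ in 𝓝[>] (0:ℝ), Measurable
      (fun u => Δ * rr Δ ^ 3 * (K Δ (rr Δ * u) ^ 2 / F Δ (rr Δ * u))) := by
    filter_upwards [ev_small (1/32) (by norm_num)] with Δ hΔ
    have h := hKm Δ (by rw [abs_of_pos hΔ.1]; exact hΔ.2)
    have h' := hFm Δ (by rw [abs_of_pos hΔ.1]; exact hΔ.2)
    have hm : Measurable (fun u : ℝ => rr Δ * u) := measurable_const_mul _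
    exact (((h.comp hm).pow_const 2).div (h'.comp hm)).const_mul _
  have hdom' : ∀ᶠ Δ in 𝓝[>] (0:ℝ), ∀ᵐ u ∂(volume.restrict (Ioi (0:ℝ))),
      ‖Δ * rr Δ ^ 3 * (K Δ (rr Δ * u) ^ 2 / F Δ (rr Δ * u))‖ ≤
        (if u ≤ 1/2 then 1 else 32 * B * u ^ (-(5:ℝ)/2)) := by
    filter_upwards [hdom] with Δ h
    exact (ae_restrict_iff' measurableSet_Ioi).2 (Eventually.of_forall h)
  constructor
  · filter_upwards [hdom', hmeas, ev_small 1 one_pos, tendsto_rr.eventually_gt_atTop 0] with Δ h1 h2 h3 h4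
    have hi : Integrable (fun u => Δ * rr Δ ^ 3 * (K Δ (rr Δ * u) ^ 2 / F Δ (rr Δ * u)))
        (volume.restrict (Ioi (0:ℝ))) :=
      Integrable.mono' (bound_integrable B) h2.aestronglyMeasurable h1
    have hne : Δ * rr Δ ^ 3 ≠ 0 := by have := h3.1; positivity
    have hi2 : IntegrableOn (fun u => K Δ (rr Δ * u) ^ 2 / F Δ (rr Δ * u)) (Ioi 0) := by
      have := hi.const_mul (Δ * rr Δ ^ 3)⁻¹
      simpa [← mul_assoc, inv_mul_cancel₀ hne, mul_inv_cancel₀ hne, IntegrableOn] using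
        this.congr (Eventually.of_forall fun u => by
          show (Δ * rr Δ ^ 3)⁻¹ * (Δ * rr Δ ^ 3 * (K Δ (rr Δ * u) ^ 2 / F Δ (rr Δ * u))) =
            K Δ (rr Δ * u) ^ 2 / F Δ (rr Δ * u)
          rw [← mul_assoc, inv_mul_cancel₀ hne, one_mul])
    have := (integrableOn_Ioi_comp_mul_left_iff (fun x => K Δ x ^ 2 / F Δ x) 0 h4).1 hi2
    simpa using this
  · have hlim := tendsto_integral_filter_of_dominated_convergence
      (μ := volume.restrict (Ioi (0:ℝ))) (l := 𝓝[>] (0:ℝ))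
      (F := fun Δ u => Δ * rr Δ ^ 3 * (K Δ (rr Δ * u) ^ 2 / F Δ (rr Δ * u)))
      (f := (Ioi 1).indicator (fun u => B * u ^ (-3 : ℝ))) _
      (by filter_upwards [hmeas] with Δ h using h.aestronglyMeasurable) hdom' (bound_integrable B)
      (by
        rw [ae_restrict_iff' measurableSet_Ioi]
        have : ∀ᵐ u : ℝ, u ≠ 1 := by simp [ae_iff]
        filter_upwards [this] with u h1 h2
        exact pointwise_lim F K B hB hder h0 hkey u h2 h1)
    have hval : ∫ u in Ioi (0:ℝ), (Ioi (1:ℝ)).indicator (fun u => B * u ^ (-3 : ℝ)) u = B / 2 := by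
      rw [setIntegral_indicator measurableSet_Ioi, Ioi_inter_Ioi]
      rw [integral_const_mul]
      rw [show max (0:ℝ) 1 = 1 by norm_num, integral_Ioi_rpow_of_lt (by norm_num) one_pos]
      norm_num
      ring
    rw [hval] at hlim
    refine hlim.congr' ?_
    filter_upwards [ev_small 1 one_pos, tendsto_rr.eventually_gt_atTop 0] with Δ h3 h4
    rw [integral_const_mul, integral_comp_mul_left_Ioi (fun x => K Δ x ^ 2 / F Δ x) 0 h4, mul_zero,
      smul_eq_mul, ← mul_assoc]
    congr 1
    have := rr_sq h3.1 h3.2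
    have e : 4 * Δ * Real.log (1 / Δ) = Δ * rr Δ ^ 2 := by rw [this]; ring
    rw [e]
    field_simp

section density

/-- the density as a function of `s = 2 - α` -/
noncomputable def FF (β s x : ℝ) : ℝ := (1 / π) * (ft x (EE s (aa β s))).re

lemma stable_eq (β s x : ℝ) : stableDensity (2 - s) β x = FF β s x := by
  unfold stableDensity FF ft
  congr 2
  refine setIntegral_congr_fun measurableSet_Ioi (fun t ht => ?_)
  have ht : 0 < t := ht
  congr 1
  unfold EE ps0 TT cA aa
  congr 1
  have e1 : Real.tan (π * (2 - s) / 2) = - Real.tan (π * s / 2) := by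
    rw [show π * (2 - s) / 2 = π - π * s / 2 by ring, Real.tan_pi_sub]
  have e2 : t ^ (2 - s) = t ^ 2 * t ^ (-s) := by
    rw [show 2 - s = 2 + -s by ring, Real.rpow_add ht]; norm_num
  have e3 : t ^ (1 - (2 - s)) * t ^ (2 - s) = t := by
    rw [← Real.rpow_add ht]; norm_num
  rw [e1]
  have e3' : ((t ^ (1 - (2 - s)) : ℝ) : ℂ) * ((t ^ (2 - s) : ℝ) : ℂ) = t := by exact_mod_cast e3
  have e2' : ((t ^ (2 - s) : ℝ) : ℂ) = (t:ℂ) ^ 2 * ((t ^ (-s) : ℝ) : ℂ) := by exact_mod_cast e2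
  push_cast
  linear_combination (Complex.I * β * Complex.tan (π * s / 2)) * e3' -
    (1 + Complex.I * β * Complex.tan (π * s / 2)) * e2'

lemma EE_dom : ∃ K : ℝ, 0 ≤ K ∧ ∀ s a b t : ℝ, |s| ≤ 1/32 → |a| ≤ 1 → |b| ≤ 4 → 0 < t →
      ‖EE s a t‖ ≤ K * dm t :=
  Bd.dom (f := fun s a _ t => EE s a t) (Bd.EEt.mono (by norm_num))

lemma EE_int {s a : ℝ} (hs : |s| ≤ 1/32) (ha : |a| ≤ 1) : IntegrableOn (EE s a) (Ioi 0) :=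
  Bd.integ (f := fun s a _ t => EE s a t) (b := 0) (Bd.EEt.mono (by norm_num)) (meas_EE s a) hs ha
    (by norm_num)

lemma GG_dom : ∃ K : ℝ, 0 ≤ K ∧ ∀ s a b t : ℝ, |s| ≤ 1/32 → |a| ≤ 1 → |b| ≤ 4 → 0 < t →
      ‖GG s a b t‖ ≤ K * dm t :=
  Bd.dom (f := GG) Bd.G

lemma GG_int {s a b : ℝ} (hs : |s| ≤ 1/32) (ha : |a| ≤ 1) (hb : |b| ≤ 4) :
    IntegrableOn (GG s a b) (Ioi 0) :=
  Bd.integ (f := GG) Bd.G (meas_GG s a b) hs ha hb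

lemma EE_deriv {β s t : ℝ} (hs : |s| < 1) (ht : 0 < t) :
    HasDerivAt (fun s => EE s (aa β s) t) (GG s (aa β s) (bb β s) t) s := by
  have ha : HasDerivAt (fun s => ((aa β s : ℝ) : ℂ)) (bb β s : ℂ) s := (aa_deriv hs).ofReal_comp
  have hT : HasDerivAt (fun s => TT s t) (-(TT s t * LL t)) s := by
    have h := (((hasDerivAt_id s).neg).const_rpow ht).ofReal_comp
    unfold TT LL
    refine h.congr_deriv ?_
    push_cast
    simp
    ring
  have h := ((((ha.const_mul Complex.I).const_add 1).neg.mul_const ((t:ℂ) ^ 2)).mul hT).add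
    ((ha.const_mul Complex.I).mul_const (t:ℂ))
  have h2 := h.cexp
  unfold EE
  refine h2.congr_deriv ?_
  unfold GG EE ps0 ch0 cA
  simp only [Pi.add_apply, Pi.mul_apply, Pi.neg_apply]
  ring_nf

lemma ft_deriv {β s : ℝ} (hβ : |β| ≤ 1) (hs : |s| < 1/32) (x : ℝ) :
    HasDerivAt (fun s => ft x (EE s (aa β s))) (ft x (GG s (aa β s) (bb β s))) s := by
  obtain ⟨K, hK, hKb⟩ := GG_dom
  have hball : ∀ y ∈ Metric.ball (0:ℝ) (1/32), |y| < 1/32 := fun y hy => by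
    simpa [Metric.mem_ball, dist_zero_right] using hy
  have hmem : Metric.ball (0:ℝ) (1/32) ∈ 𝓝 s :=
    Metric.isOpen_ball.mem_nhds (by simpa [Metric.mem_ball, dist_zero_right] using hs)
  have := hasDerivAt_integral_of_dominated_loc_of_deriv_le (μ := volume.restrict (Ioi (0:ℝ)))
    (F := fun s t => Complex.exp (-(Complex.I * (t:ℂ) * (x:ℂ))) * EE s (aa β s) t)
    (F' := fun s t => Complex.exp (-(Complex.I * (t:ℂ) * (x:ℂ))) * GG s (aa β s) (bb β s) t)
    (x₀ := s) (bound := fun t => K * dm t) hmem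
    (Eventually.of_forall (fun y => ((meas_ker x).mul (meas_EE _ _)).aestronglyMeasurable))
    (ker_int x (EE_int hs.le (aa_le hβ hs.le)))
    (((meas_ker x).mul (meas_GG _ _ _)).aestronglyMeasurable)
    ((ae_restrict_iff' measurableSet_Ioi).2 (Eventually.of_forall (fun t ht y hy => by
      rw [norm_mul, norm_ker, one_mul]
      have hy := (hball y hy).le
      exact hKb _ _ _ _ hy (aa_le hβ hy) (bb_le hβ hy) ht)))
    (dm_int.const_mul K)
    ((ae_restrict_iff' measurableSet_Ioi).2 (Eventually.of_forall (fun t ht y hy => by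
      have hy := (hball y hy)
      exact (EE_deriv (by linarith) ht).const_mul _)))
  exact this.2

lemma FF_deriv {β : ℝ} (hβ : |β| ≤ 1) (x s : ℝ) (hs : |s| < 1/32) :
    HasDerivAt (fun s => FF β s x) (KK β s x) s := by
  have h := (Complex.reCLM.hasFDerivAt.comp_hasDerivAt s (ft_deriv hβ hs x)).const_mul (1 / π)
  exact h

lemma ft_meas {F : ℝ → ℂ} (hF : IntegrableOn F (Ioi 0)) : Measurable (fun x => ft x F) := by
  refine Continuous.measurable ?_
  unfold ft
  refine continuous_of_dominated (bound := fun t => ‖F t‖) (fun x => (ker_int x hF).aestronglyMeasurable)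
    (fun x => Eventually.of_forall (fun t => ?_)) hF.norm (Eventually.of_forall (fun t => ?_))
  · rw [norm_mul, norm_ker, one_mul]
  · fun_prop

lemma FF_meas {β s : ℝ} (hβ : |β| ≤ 1) (hs : |s| < 1/32) : Measurable (FF β s) := by
  have := ft_meas (EE_int hs.le (aa_le hβ hs.le))
  unfold FF
  exact (Complex.measurable_re.comp this).const_mul _

lemma KK_meas {β s : ℝ} (hβ : |β| ≤ 1) (hs : |s| < 1/32) : Measurable (KK β s) := by
  have := ft_meas (GG_int hs.le (aa_le hβ hs.le) (bb_le hβ hs.le))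
  unfold KK
  exact (Complex.measurable_re.comp this).const_mul _

lemma KK_bdd {β : ℝ} (hβ : |β| ≤ 1) : ∃ C : ℝ, ∀ s x, |s| < 1/32 → |KK β s x| ≤ C := by
  obtain ⟨K, hK, hKb⟩ := GG_dom
  refine ⟨(1 / π) * ∫ t in Ioi (0:ℝ), K * dm t, fun s x hs => ?_⟩
  have hp := Real.pi_pos
  unfold KK
  rw [abs_mul, abs_of_pos (show 0 < 1 / π by positivity)]
  gcongr
  refine (Complex.abs_re_le_norm _).trans ((ft_norm_le x).trans ?_)
  refine setIntegral_mono_on (GG_int hs.le (aa_le hβ hs.le) (bb_le hβ hs.le)).norm (dm_int.const_mul K)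
    measurableSet_Ioi (fun t ht => hKb _ _ _ _ hs.le (aa_le hβ hs.le) (bb_le hβ hs.le) ht)

lemma FF_zero (β x : ℝ) : FF β 0 x = normalDensity x := by
  have hp := Real.pi_pos
  set g : ℝ → ℂ := fun t => Complex.exp (Complex.I * ((-x : ℝ) : ℂ) * t) * Complex.exp (-(1:ℂ) * (t:ℂ) ^ 2) with hg
  have hJ : ∫ t : ℝ, g t = (π / 1 : ℂ) ^ (1 / 2 : ℂ) * Complex.exp (-(((-x : ℝ) : ℂ)) ^ 2 / (4 * 1)) :=
    fourierIntegral_gaussian (b := 1) (by norm_num) _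
  have hE : EE 0 (aa β 0) = fun t : ℝ => Complex.exp (-(1:ℂ) * (t:ℂ) ^ 2) := by
    funext t; rw [aa_zero]; simp [EE, ps0, cA, TT]
  have hft : ft x (EE 0 (aa β 0)) = ∫ t in Ioi (0:ℝ), g t := by
    rw [hE]; unfold ft
    congr 1; funext t; simp only [hg]
    congr 2; push_cast; ring
  have hInteg0 : Integrable (fun t : ℝ => Complex.exp (-(1:ℂ) * (t:ℂ) ^ 2)) :=
    integrable_cexp_neg_mul_sq (by norm_num)
  have hInteg : Integrable g := by
    refine Integrable.bdd_mul (c := 1) hInteg0 (by fun_prop) (Eventually.of_forall (fun t => ?_))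
    rw [Complex.norm_exp]; simp
  have hneg : ∫ t in Iic (0:ℝ), g t = (starRingEnd ℂ) (∫ t in Ioi (0:ℝ), g t) := by
    have h := integral_comp_neg_Ioi (0:ℝ) g
    rw [neg_zero] at h
    rw [← h, ← integral_conj]
    congr 1; funext t
    simp only [hg, map_mul, ← Complex.exp_conj]
    congr 2 <;> simp
  have hsum : ∫ t : ℝ, g t = ((2 * (∫ t in Ioi (0:ℝ), g t).re : ℝ) : ℂ) := by
    rw [← intervalIntegral.integral_Iic_add_Ioi (b := 0) hInteg.integrableOn hInteg.integrableOn, hneg, add_comm,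
      Complex.add_conj]
  have hval : ((π:ℂ) / 1) ^ (1 / 2 : ℂ) * Complex.exp (-(((-x : ℝ) : ℂ)) ^ 2 / (4 * 1)) =
      ((√π * Real.exp (-(x ^ 2) / 4) : ℝ) : ℂ) := by
    rw [Real.sqrt_eq_rpow]
    push_cast
    rw [Complex.ofReal_cpow hp.le]
    push_cast
    congr 2
    · simp
    · ring
  rw [hsum, hval] at hJ
  have h := Complex.ofReal_injective hJ
  unfold FF normalDensity
  rw [hft]
  have hs : √π * √π = π := Real.mul_self_sqrt hp.le
  have hs0 : 0 < √π := Real.sqrt_pos.2 hp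
  have h2 : (∫ t in Ioi (0:ℝ), g t).re = √π * Real.exp (-(x ^ 2) / 4) / 2 := by linarith
  rw [h2]
  nth_rewrite 1 [← hs]
  field_simp

lemma FF_neg (β s x : ℝ) : FF β s (-x) = FF (-β) s x := by
  unfold FF
  have : ft (-x) (EE s (aa β s)) = (starRingEnd ℂ) (ft x (EE s (aa (-β) s))) := by
    unfold ft
    rw [← integral_conj]
    congr 1; funext t
    have ha : aa (-β) s = - aa β s := by unfold aa; ring
    rw [ha]
    unfold EE ps0 cA TT
    simp only [map_mul, ← Complex.exp_conj]
    congr 2 <;> simp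
  rw [this, Complex.conj_re]

lemma stable_neg (α β x : ℝ) : stableDensity α β (-x) = stableDensity α (-β) x := by
  have e : α = 2 - (2 - α) := by ring
  rw [e, stable_eq, stable_eq, FF_neg]

lemma fAlpha_neg (α β x : ℝ) : fAlpha α β (-x) = fAlpha α (-β) x := by
  unfold fAlpha
  congr 1; funext a; exact stable_neg a β x

lemma fAlpha_eq {β : ℝ} (hβ : |β| ≤ 1) {s : ℝ} (hs : |s| < 1/32) (x : ℝ) :
    fAlpha (2 - s) β x = - KK β s x := by
  unfold fAlpha
  have e : (fun a : ℝ => stableDensity a β x) = fun a => FF β (2 - a) x := by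
    funext a; rw [← stable_eq]; congr 1; ring
  rw [e]
  have h := FF_deriv hβ x s hs
  have h2 : HasDerivAt (fun a : ℝ => 2 - a) (-1) (2 - s) := by
    simpa using (hasDerivAt_id (2 - s)).const_sub 2
  have h3 : HasDerivAt (fun s => FF β s x) (KK β s x) (2 - (2 - s)) := by
    rw [sub_sub_cancel]; exact h
  have := (h3.comp (2 - s) h2).deriv
  rw [mul_neg_one] at this
  exact this

/-- half-line statement -/
lemma half_line {β : ℝ} (hβ : β ∈ Ioo (-1:ℝ) 1) :
    (∀ᶠ Δ in 𝓝[>] (0:ℝ), IntegrableOn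
      (fun x => fAlpha (2 - Δ) β x ^ 2 / stableDensity (2 - Δ) β x) (Ioi 0)) ∧
    Tendsto (fun Δ => 4 * Δ * Real.log (1 / Δ) *
      ∫ x in Ioi (0:ℝ), fAlpha (2 - Δ) β x ^ 2 / stableDensity (2 - Δ) β x)
      (𝓝[>] 0) (𝓝 ((1 + β) / 2)) := by
  have hb : |β| ≤ 1 := abs_le.2 ⟨hβ.1.le, hβ.2.le⟩
  obtain ⟨C, hC⟩ := KK_bdd hb
  have h := partC (FF β) (KK β) (1 + β) C (by linarith [hβ.1]) (FF_deriv hb) (FF_zero β) hC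
    (fun s hs => KK_meas hb hs) (fun s hs => FF_meas hb hs) (key_lim β hb)
  have hev : ∀ᶠ Δ in 𝓝[>] (0:ℝ), (fun x => KK β Δ x ^ 2 / FF β Δ x) =
      (fun x => fAlpha (2 - Δ) β x ^ 2 / stableDensity (2 - Δ) β x) := by
    have : Metric.ball (0:ℝ) (1/32) ∈ 𝓝 (0:ℝ) := Metric.ball_mem_nhds _ (by norm_num)
    filter_upwards [nhdsWithin_le_nhds this] with Δ hΔ
    have hs : |Δ| < 1/32 := by simpa [Metric.mem_ball, dist_zero_right] using hΔ
    funext x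
    rw [fAlpha_eq hb hs, stable_eq, neg_sq]
  constructor
  · filter_upwards [h.1, hev] with Δ h1 h2
    rw [← h2]; exact h1
  · refine h.2.congr' ?_
    filter_upwards [hev] with Δ h2
    rw [← h2]

end density

theorem fisher_information_alpha_alpha (β : ℝ) (hβ : β ∈ Set.Ioo (-1 : ℝ) 1) :
    Filter.Tendsto
      (fun Δ : ℝ => 4 * Δ * Real.log (1 / Δ) *
        ∫ x : ℝ, (fAlpha (2 - Δ) β x) ^ 2 / stableDensity (2 - Δ) β x)
      (nhdsWithin 0 (Set.Ioi 0)) (nhds 1) := by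
  obtain ⟨p1, p2⟩ := half_line hβ
  obtain ⟨n1, n2⟩ := half_line (β := -β) ⟨by linarith [hβ.2], by linarith [hβ.1]⟩
  have hsum := p2.add n2
  have e : (1 + β) / 2 + (1 + -β) / 2 = 1 := by ring
  rw [e] at hsum
  refine hsum.congr' ?_
  filter_upwards [p1, n1] with Δ h1 h2
  set g : ℝ → ℝ := fun x => fAlpha (2 - Δ) β x ^ 2 / stableDensity (2 - Δ) β x with hg
  have hgn : (fun x => fAlpha (2 - Δ) (-β) x ^ 2 / stableDensity (2 - Δ) (-β) x) = fun x => g (-x) := by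
    funext x
    simp only [hg]
    rw [fAlpha_neg, stable_neg]
  rw [hgn] at h2
  have h3 : IntegrableOn g (Iic 0) := by
    have := h2.comp_neg
    rw [integrableOn_Iic_iff_integrableOn_Iio]
    simpa using this
  have h4 := integral_comp_neg_Ioi (0:ℝ) g
  rw [neg_zero] at h4
  rw [hgn, h4, ← intervalIntegral.integral_Iic_add_Ioi (b := 0) h3 h1]
  ring
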